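/- arXiv:2203.00406 — 3 statements merged into one kernel-verified Lean document; each statement's English description precedes it below -/
import Mathlib

section
/- Let α ∈ (ℤ≥0)^m and β ∈ (ℤ≥0)^n with |α| = |β| = K > 1. The map sending B = (b_{kl}) ∈ W̃_K to the matrix A = (a_{ij}) with a_{ij} = Σ_{(k,l)∈𝓘_i×𝓙_j} b_{kl} restricts to a bijection from the set W̃_{K,(α,β)} of (α,β)-descending extended affine permutations onto M̂_{m×n}(α,β); equivalently, for every A ∈ M̂_{m×n}(α,β) there is a unique (α,β)-descending B ∈ W̃_K whose blockwise entry sums over the 𝓘_i × 𝓙_j equal the entries of A. -/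
open scoped Classical

namespace AffineRSK

/-- `ℤ × ℤ`-matrices with non-negative integer entries. -/
abbrev Mat : Type := ℤ → ℤ → ℕ

abbrev Cell : Type := ℤ × ℤ

/-- Generalized affine permutations of period `(m, n)`:
`a_{i+m, j+n} = a_{ij}` and each column has finite support. -/
def IsGAP (m n : ℕ) (A : Mat) : Prop :=
  (∀ i j : ℤ, A (i + m) (j + n) = A i j) ∧ ∀ j : ℤ, {i : ℤ | A i j ≠ 0}.Finite

/-- Generalized dual affine permutations: entries in `{0, 1}`. -/
def IsGDAP (m n : ℕ) (A : Mat) : Prop :=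
  IsGAP m n A ∧ ∀ i j : ℤ, A i j ≤ 1

def supp (A : Mat) : Set Cell := {c : Cell | A c.1 c.2 ≠ 0}

def tauC (m n : ℕ) (c : Cell) : Cell := (c.1 + (m : ℤ), c.2 + (n : ℤ))

/-- `NW c₁ c₂` means `c₁ >_NW c₂`. -/
def NW (c₁ c₂ : Cell) : Prop := c₁.1 < c₂.1 ∧ c₁.2 < c₂.2

/-- `nwGe c₁ c₂` means `c₁ ≥_nw c₂`. -/
def nwGe (c₁ c₂ : Cell) : Prop := c₁.1 ≤ c₂.1 ∧ c₁.2 ≤ c₂.2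

/-- `neLe c₁ c₂` means `c₁ ≤_ne c₂`. -/
def neLe (c₁ c₂ : Cell) : Prop := c₂.1 ≤ c₁.1 ∧ c₁.2 ≤ c₂.2

/-- `nWgt c₁ c₂` means `c₁ >_nW c₂` (dual order). -/
def nWgt (c₁ c₂ : Cell) : Prop := c₁.1 ≤ c₂.1 ∧ c₁.2 < c₂.2

/-- `NeLt c₁ c₂` means `c₁ <_Ne c₂` (dual order). -/
def NeLt (c₁ c₂ : Cell) : Prop := c₂.1 < c₁.1 ∧ c₁.2 ≤ c₂.2

/-- A proper numbering on `A`. -/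
def IsProper (A : Mat) (d : Cell → ℤ) : Prop :=
  (∀ c₁ ∈ supp A, ∀ c₂ ∈ supp A, NW c₂ c₁ → d c₂ < d c₁) ∧
    ∀ c₁ ∈ supp A, ∃ c₂ ∈ supp A, NW c₂ c₁ ∧ d c₂ = d c₁ - 1

/-- A dual proper numbering on `A`. -/
def IsProper' (A : Mat) (d : Cell → ℤ) : Prop :=
  (∀ c₁ ∈ supp A, ∀ c₂ ∈ supp A, nWgt c₂ c₁ → d c₂ < d c₁) ∧
    ∀ c₁ ∈ supp A, ∃ c₂ ∈ supp A, nWgt c₂ c₁ ∧ d c₂ = d c₁ - 1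

/-- An enumeration of a stream of flow `l`. -/
def IsStreamEnum (m n : ℕ) (e : ℤ → Cell) (l : ℕ) : Prop :=
  0 < l ∧ (∀ i : ℤ, NW (e i) (e (i + 1))) ∧ ∀ i : ℤ, tauC m n (e i) = e (i + l)

def IsStreamEnum' (m n : ℕ) (e : ℤ → Cell) (l : ℕ) : Prop :=
  0 < l ∧ (∀ i : ℤ, nWgt (e i) (e (i + 1))) ∧ ∀ i : ℤ, tauC m n (e i) = e (i + l)

def IsStream (m n : ℕ) (S : Set Cell) (l : ℕ) : Prop :=
  ∃ e : ℤ → Cell, IsStreamEnum m n e l ∧ Set.range e = S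

def IsStream' (m n : ℕ) (S : Set Cell) (l : ℕ) : Prop :=
  ∃ e : ℤ → Cell, IsStreamEnum' m n e l ∧ Set.range e = S

/-- A channel of `A`: a stream contained in `supp A` of maximal flow. -/
def IsChannel (m n : ℕ) (A : Mat) (C : Set Cell) : Prop :=
  ∃ l : ℕ, IsStream m n C l ∧ C ⊆ supp A ∧
    ∀ (S : Set Cell) (l' : ℕ), IsStream m n S l' → S ⊆ supp A → l' ≤ l

def IsChannel' (m n : ℕ) (A : Mat) (C : Set Cell) : Prop :=
  ∃ l : ℕ, IsStream' m n C l ∧ C ⊆ supp A ∧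
    ∀ (S : Set Cell) (l' : ℕ), IsStream' m n S l' → S ⊆ supp A → l' ≤ l

def Csw (A : Mat) (C : Set Cell) : Set Cell :=
  {c ∈ supp A | ∃ c' ∈ C, neLe c c'}

def Csw' (A : Mat) (C : Set Cell) : Set Cell :=
  {c ∈ supp A | c ∈ C ∨ ∃ c' ∈ C, NeLt c c'}

/-- `swGe A C₁ C₂` means `C₁ ≽_sw C₂`. -/
def swGe (A : Mat) (C₁ C₂ : Set Cell) : Prop := C₁ ⊆ Csw A C₂

def swGe' (A : Mat) (C₁ C₂ : Set Cell) : Prop := C₁ ⊆ Csw' A C₂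

/-- The set of values `d₀(c'_k) + k` over `>_NW`-chains from `c` to the channel
enumerated by `e` (where `d₀ (e idx) = idx`). -/
def chainSet (A : Mat) (e : ℤ → Cell) (c : Cell) : Set ℤ :=
  {v : ℤ | ∃ (k : ℕ) (ch : ℕ → Cell),
      ch 0 = c ∧ (∀ i ≤ k, ch i ∈ supp A) ∧ (∀ i < k, NW (ch (i + 1)) (ch i)) ∧
        ∃ idx : ℤ, e idx = ch k ∧ v = idx + (k : ℤ)}

def chainSet' (A : Mat) (e : ℤ → Cell) (c : Cell) : Set ℤ :=
  {v : ℤ | ∃ (k : ℕ) (ch : ℕ → Cell),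
      ch 0 = c ∧ (∀ i ≤ k, ch i ∈ supp A) ∧ (∀ i < k, nWgt (ch (i + 1)) (ch i)) ∧
        ∃ idx : ℤ, e idx = ch k ∧ v = idx + (k : ℤ)}

/-- `d` is the channel numbering `d^C_A` for the channel enumerated by `e`. -/
def IsChannelNumbering (A : Mat) (e : ℤ → Cell) (d : Cell → ℤ) : Prop :=
  ∀ c ∈ supp A, IsGreatest (chainSet A e c) (d c)

def IsChannelNumbering' (A : Mat) (e : ℤ → Cell) (d : Cell → ℤ) : Prop :=
  ∀ c ∈ supp A, IsGreatest (chainSet' A e c) (d c)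

/-- `e` enumerates the southwest channel of `A`. -/
def IsSWChannelEnum (m n : ℕ) (A : Mat) (e : ℤ → Cell) : Prop :=
  (∃ l : ℕ, IsStreamEnum m n e l) ∧ IsChannel m n A (Set.range e) ∧
    ∀ C : Set Cell, IsChannel m n A C → swGe A (Set.range e) C

def IsSWChannelEnum' (m n : ℕ) (A : Mat) (e : ℤ → Cell) : Prop :=
  (∃ l : ℕ, IsStreamEnum' m n e l) ∧ IsChannel' m n A (Set.range e) ∧
    ∀ C : Set Cell, IsChannel' m n A C → swGe' A (Set.range e) C

/-- `d` is a southwest channel numbering of `A`. -/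
def IsSWNumbering (m n : ℕ) (A : Mat) (d : Cell → ℤ) : Prop :=
  ∃ e : ℤ → Cell, IsSWChannelEnum m n A e ∧ IsChannelNumbering A e d

def IsSWNumbering' (m n : ℕ) (A : Mat) (d : Cell → ℤ) : Prop :=
  ∃ e : ℤ → Cell, IsSWChannelEnum' m n A e ∧ IsChannelNumbering' A e d

/-- A zig-zag: bi-infinite east/north lattice path, eventually east on the
right and coming from the south on the left. -/
def IsZigZag (z : ℤ → Cell) : Prop :=
  (∀ i : ℤ, z (i + 1) = ((z i).1, (z i).2 + 1) ∨ z (i + 1) = ((z i).1 - 1, (z i).2)) ∧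
  (∃ N : ℤ, ∀ i : ℤ, N ≤ i → z (i + 1) = ((z i).1, (z i).2 + 1)) ∧
    ∃ N : ℤ, ∀ i : ℤ, i ≤ N → z (i + 1) = ((z i).1 - 1, (z i).2)

def innerCorners (z : ℤ → Cell) : Set Cell :=
  {c : Cell | ∃ i : ℤ, z i = c ∧ z i = ((z (i - 1)).1 - 1, (z (i - 1)).2) ∧
      z (i + 1) = ((z i).1, (z i).2 + 1)}

def outerCorners (z : ℤ → Cell) : Set Cell :=
  {c : Cell | ∃ i : ℤ, z i = c ∧ z i = ((z (i - 1)).1, (z (i - 1)).2 + 1) ∧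
      z (i + 1) = ((z i).1 - 1, (z i).2)}

def levelSet (A : Mat) (d : Cell → ℤ) (k : ℤ) : Set Cell := {c ∈ supp A | d c = k}

/-- `≥_nw`-maximal cells of `S`. -/
def nwMaximal (S : Set Cell) : Set Cell := {c ∈ S | ∀ c' ∈ S, nwGe c' c → c' = c}

/-- `>_nW`-maximal cells of `S` (dual). -/
def nWMaximal (S : Set Cell) : Set Cell := {c ∈ S | ∀ c' ∈ S, ¬ nWgt c' c}

/-- `z` is the zig-zag at level `k` associated to the numbering `d`. -/
def ZigZagAt (A : Mat) (d : Cell → ℤ) (k : ℤ) (z : ℤ → Cell) : Prop :=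
  IsZigZag z ∧ innerCorners z = nwMaximal (levelSet A d k)

def ZigZagAt' (A : Mat) (d : Cell → ℤ) (k : ℤ) (z : ℤ → Cell) : Prop :=
  IsZigZag z ∧ innerCorners z = nWMaximal (levelSet A d k)

def IsInnerOf (A : Mat) (d : Cell → ℤ) (c : Cell) : Prop :=
  ∃ (k : ℤ) (z : ℤ → Cell), ZigZagAt A d k z ∧ c ∈ innerCorners z

def IsOuterOf (A : Mat) (d : Cell → ℤ) (c : Cell) : Prop :=
  ∃ (k : ℤ) (z : ℤ → Cell), ZigZagAt A d k z ∧ c ∈ outerCorners z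

def IsInnerOf' (A : Mat) (d : Cell → ℤ) (c : Cell) : Prop :=
  ∃ (k : ℤ) (z : ℤ → Cell), ZigZagAt' A d k z ∧ c ∈ innerCorners z

def IsOuterOf' (A : Mat) (d : Cell → ℤ) (c : Cell) : Prop :=
  ∃ (k : ℤ) (z : ℤ → Cell), ZigZagAt' A d k z ∧ c ∈ outerCorners z

/-- `B` is obtained from `A` by subtracting `1` at inner corners and adding `1`
at outer corners. -/
def FlatEntries (A B : Mat) (Inn Out : Cell → Prop) : Prop :=
  ∀ c : Cell,
    (Inn c → B c.1 c.2 + 1 = A c.1 c.2) ∧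
    (Out c → B c.1 c.2 = A c.1 c.2 + 1) ∧
    (¬ Inn c → ¬ Out c → B c.1 c.2 = A c.1 c.2)

/-- `B = A^♭`. -/
def FlatRel (m n : ℕ) (A B : Mat) : Prop :=
  ∃ d : Cell → ℤ, IsSWNumbering m n A d ∧
    FlatEntries A B (IsInnerOf A d) (IsOuterOf A d)

/-- `B = A^{♭'}` (dual). -/
def FlatRel' (m n : ℕ) (A B : Mat) : Prop :=
  ∃ d : Cell → ℤ, IsSWNumbering' m n A d ∧
    FlatEntries A B (IsInnerOf' A d) (IsOuterOf' A d)

/-- `c` is the back-post corner of the zig-zag `z`: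
`(row of rightmost inner corner, column of leftmost inner corner)`. -/
def IsBackPost (z : ℤ → Cell) (c : Cell) : Prop :=
  ∃ cr ∈ innerCorners z, ∃ cl ∈ innerCorners z,
    (∀ c' ∈ innerCorners z, c'.2 ≤ cr.2) ∧ (∀ c' ∈ innerCorners z, cl.2 ≤ c'.2) ∧
      c = (cr.1, cl.2)

def backPostSet (A : Mat) (d : Cell → ℤ) : Set Cell :=
  {c : Cell | ∃ (k : ℤ) (z : ℤ → Cell), ZigZagAt A d k z ∧ IsBackPost z c}

def backPostSet' (A : Mat) (d : Cell → ℤ) : Set Cell :=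
  {c : Cell | ∃ (k : ℤ) (z : ℤ → Cell), ZigZagAt' A d k z ∧ IsBackPost z c}

/-- Defining data `(a, b, r)` of the stream enumerated by `e` of flow `l`. -/
def StreamData (m n : ℕ) (e : ℤ → Cell) (l : ℕ) (a b : ℕ → ℤ) (r : ℤ) : Prop :=
  ∃ r₁ r₂ : ℤ,
    (∀ p : ℕ, p < l → a p = (e (r₁ + 1 + p)).1 ∧ 1 ≤ a p ∧ a p ≤ (m : ℤ)) ∧
    (∀ p : ℕ, p < l → b p = (e (r₂ + 1 + p)).2 ∧ 1 ≤ b p ∧ b p ≤ (n : ℤ)) ∧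
      r = r₁ - r₂

/-- The matrix-ball iteration `A = A^(0), A^(t) = (A^(t-1))^♭`, with
`A^(t) ≠ O` for `t < s` and `A^(s) = O`. -/
def MBCseq (m n : ℕ) (A : Mat) (s : ℕ) (Aseq : ℕ → Mat) : Prop :=
  Aseq 0 = A ∧ (∀ t < s, Aseq t ≠ 0) ∧ Aseq s = 0 ∧
    ∀ t < s, FlatRel m n (Aseq t) (Aseq (t + 1))

def MBCseq' (m n : ℕ) (A : Mat) (s : ℕ) (Aseq : ℕ → Mat) : Prop :=
  Aseq 0 = A ∧ (∀ t < s, Aseq t ≠ 0) ∧ Aseq s = 0 ∧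
    ∀ t < s, FlatRel' m n (Aseq t) (Aseq (t + 1))

/-- `κ₀(A) = (P, Q, ρ)`, with shape given by the column lengths `μ`:
the `t`-th columns (from the left, `0`-based) of `P` and `Q` are the defining
data of the stream of back-post corners of the zig-zags of `d^{sw}_{A^(t)}`. -/
def Kappa0Rel (m n : ℕ) (A : Mat) (s : ℕ) (μ : ℕ → ℕ) (P Q : ℕ → ℕ → ℤ)
    (ρ : ℕ → ℤ) : Prop :=
  ∃ Aseq : ℕ → Mat, MBCseq m n A s Aseq ∧
    ∀ t < s, ∃ (d : Cell → ℤ) (e : ℤ → Cell),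
      IsSWNumbering m n (Aseq t) d ∧ IsStreamEnum m n e (μ t) ∧
        Set.range e = backPostSet (Aseq t) d ∧
        StreamData m n e (μ t) (fun x => P x t) (fun x => Q x t) (ρ t)

def Kappa0Rel' (m n : ℕ) (A : Mat) (s : ℕ) (μ : ℕ → ℕ) (P Q : ℕ → ℕ → ℤ)
    (ρ : ℕ → ℤ) : Prop :=
  ∃ Aseq : ℕ → Mat, MBCseq' m n A s Aseq ∧
    ∀ t < s, ∃ (d : Cell → ℤ) (e : ℤ → Cell),
      IsSWNumbering' m n (Aseq t) d ∧ IsStreamEnum' m n e (μ t) ∧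
        Set.range e = backPostSet' (Aseq t) d ∧
        StreamData m n e (μ t) (fun x => P x t) (fun x => Q x t) (ρ t)

/-! ### Columns and the shift `τ` -/

/-- Extension of a column `c` of length `b` to `ℤ`: `c̃(x + bq) = c(x) + nq`. -/
def colExt (n b : ℕ) (c : ℕ → ℤ) (z : ℤ) : ℤ :=
  c (Int.toNat (Int.emod z (b : ℤ))) + (n : ℤ) * Int.ediv z (b : ℤ)

/-- `τ_n^k` applied to a column of length `b`. -/
def tauPow (n b : ℕ) (k : ℤ) (c : ℕ → ℤ) : ℕ → ℤ :=
  fun x => colExt n b c ((x : ℤ) + k)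

/-- The two-column tableau `(column t of T, τ_N^r(column (t+1) of T))`
(both of height `μ t`) is `ℤ`-semistandard. -/
def pairCond (N : ℕ) (μ : ℕ → ℕ) (T : ℕ → ℕ → ℤ) (t : ℕ) (r : ℕ) : Prop :=
  (∀ x : ℕ, x + 1 < μ t → T x t < T (x + 1) t) ∧
  (∀ x : ℕ, x + 1 < μ t →
    tauPow N (μ t) (r : ℤ) (fun y => T y (t + 1)) x <
      tauPow N (μ t) (r : ℤ) (fun y => T y (t + 1)) (x + 1)) ∧
    ∀ x < μ t, T x t ≤ tauPow N (μ t) (r : ℤ) (fun y => T y (t + 1)) x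

/-- The offset `r` for the adjacent pair of columns `(t, t+1)`. -/
noncomputable def rOff (N : ℕ) (μ : ℕ → ℕ) (T : ℕ → ℕ → ℤ) (t : ℕ) : ℕ :=
  sInf {r : ℕ | pairCond N μ T t r}

/-- Dual version: placing row `t` above row `τ_N^r(row (t+1))` (rows of the
transposed tableau, i.e. columns of `T`) is `ℤ`-semistandard. -/
def dualPairCond (N : ℕ) (μ : ℕ → ℕ) (T : ℕ → ℕ → ℤ) (t : ℕ) (r : ℕ) : Prop :=
  (∀ x : ℕ, x + 1 < μ t → T x t ≤ T (x + 1) t) ∧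
  (∀ x : ℕ, x + 1 < μ t →
    tauPow N (μ t) (r : ℤ) (fun y => T y (t + 1)) x ≤
      tauPow N (μ t) (r : ℤ) (fun y => T y (t + 1)) (x + 1)) ∧
    ∀ x < μ t, T x t < tauPow N (μ t) (r : ℤ) (fun y => T y (t + 1)) x

noncomputable def rOffDual (N : ℕ) (μ : ℕ → ℕ) (T : ℕ → ℕ → ℤ) (t : ℕ) : ℕ :=
  sInf {r : ℕ | dualPairCond N μ T t r}

/-- First column of the rectangle block containing column `t`. -/
noncomputable def blockStart (μ : ℕ → ℕ) (t : ℕ) : ℕ := sInf {t' : ℕ | μ t' = μ t}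

/-- The symmetrized offset entry attached to column `t`
(`η_j` where `j` is the position of `t` from the right in its block). -/
noncomputable def etaCol (N : ℕ) (μ : ℕ → ℕ) (T : ℕ → ℕ → ℤ) (t : ℕ) : ℕ :=
  ∑ u ∈ Finset.Ico (blockStart μ t) t, rOff N μ T u

noncomputable def etaColDual (N : ℕ) (μ : ℕ → ℕ) (T : ℕ → ℕ → ℤ) (t : ℕ) : ℕ :=
  ∑ u ∈ Finset.Ico (blockStart μ t) t, rOffDual N μ T u

/-- Entries outside the shape are normalized to `0`. -/
def PadZeroT (s : ℕ) (μ : ℕ → ℕ) (T : ℕ → ℕ → ℤ) : Prop :=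
  ∀ x t : ℕ, s ≤ t ∨ μ t ≤ x → T x t = 0

/-- `μ` encodes (the conjugate of) a partition `λ ∈ 𝒫_m ∩ 𝒫_n` with `s` columns. -/
def ShapeOK (m n s : ℕ) (μ : ℕ → ℕ) : Prop :=
  (∀ t : ℕ, t + 1 < s → μ (t + 1) ≤ μ t) ∧ (∀ t < s, 0 < μ t ∧ μ t ≤ m ∧ μ t ≤ n) ∧
    ∀ t : ℕ, s ≤ t → μ t = 0

/-- Dual shape condition: `λ ∈ 𝒫_n`. -/
def ShapeOK' (n s : ℕ) (μ : ℕ → ℕ) : Prop :=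
  (∀ t : ℕ, t + 1 < s → μ (t + 1) ≤ μ t) ∧ (∀ t < s, 0 < μ t ∧ μ t ≤ n) ∧
    ∀ t : ℕ, s ≤ t → μ t = 0

/-- `κ(A) = (P, Q)` where `Q` is obtained by shifting the `t`-th column of `Q₀`
by `τ_n^{ρ_t + η_t}` (`η` the symmetrized offset vector of `P₀`). -/
def KappaRel (m n : ℕ) (A : Mat) (s : ℕ) (μ : ℕ → ℕ) (P Q : ℕ → ℕ → ℤ) : Prop :=
  ∃ (P' Q' : ℕ → ℕ → ℤ) (ρ : ℕ → ℤ),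
    Kappa0Rel m n A s μ P' Q' ρ ∧
    (∀ t < s, ∀ x < μ t,
      P x t = P' x t ∧
        Q x t = tauPow n (μ t) (ρ t + (etaCol m μ P' t : ℤ)) (fun y => Q' y t) x) ∧
    PadZeroT s μ P ∧ PadZeroT s μ Q ∧ ∀ t : ℕ, s ≤ t → μ t = 0

def KappaRel' (m n : ℕ) (A : Mat) (s : ℕ) (μ : ℕ → ℕ) (P Q : ℕ → ℕ → ℤ) : Prop :=
  ∃ (P' Q' : ℕ → ℕ → ℤ) (ρ : ℕ → ℤ),
    Kappa0Rel' m n A s μ P' Q' ρ ∧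
    (∀ t < s, ∀ x < μ t,
      P x t = P' x t ∧
        Q x t = tauPow n (μ t) (ρ t + (etaColDual m μ P' t : ℤ)) (fun y => Q' y t) x) ∧
    PadZeroT s μ P ∧ PadZeroT s μ Q ∧ ∀ t : ℕ, s ≤ t → μ t = 0

/-- Membership in `⨆_{λ ∈ 𝒫_m ∩ 𝒫_n} CSST_[m](λ) × B_n(λ)`:
`P` is column semistandard with entries in `{1, …, m}` and `Q` is a
`ℤ`-semistandard filling whose columns span less than `n` and whose rows
weakly increase within each rectangle block. -/
def InTargetRSK (m n s : ℕ) (μ : ℕ → ℕ) (P Q : ℕ → ℕ → ℤ) : Prop :=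
  ShapeOK m n s μ ∧ PadZeroT s μ P ∧ PadZeroT s μ Q ∧
  (∀ t < s, ∀ x : ℕ, x + 1 < μ t → P x t < P (x + 1) t) ∧
  (∀ t < s, ∀ x < μ t, 1 ≤ P x t ∧ P x t ≤ (m : ℤ)) ∧
  (∀ t < s, ∀ x : ℕ, x + 1 < μ t → Q x t < Q (x + 1) t) ∧
  (∀ t < s, Q (μ t - 1) t - Q 0 t < (n : ℤ)) ∧
    ∀ t : ℕ, t + 1 < s → μ t = μ (t + 1) → ∀ x < μ t, Q x t ≤ Q x (t + 1)

/-- Membership in `⨆_{λ ∈ 𝒫_n} RSST_[m](λ') × B_n(λ)`; the first component is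
encoded by `P = P₀` (whose columns, weakly increasing with entries in
`{1, …, m}`, are the rows of `P₀ᵗ ∈ RSST_[m](λ')`). -/
def InTargetDual (m n s : ℕ) (μ : ℕ → ℕ) (P Q : ℕ → ℕ → ℤ) : Prop :=
  ShapeOK' n s μ ∧ PadZeroT s μ P ∧ PadZeroT s μ Q ∧
  (∀ t < s, ∀ x : ℕ, x + 1 < μ t → P x t ≤ P (x + 1) t) ∧
  (∀ t < s, ∀ x < μ t, 1 ≤ P x t ∧ P x t ≤ (m : ℤ)) ∧
  (∀ t < s, ∀ x : ℕ, x + 1 < μ t → Q x t < Q (x + 1) t) ∧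
  (∀ t < s, Q (μ t - 1) t - Q 0 t < (n : ℤ)) ∧
    ∀ t : ℕ, t + 1 < s → μ t = μ (t + 1) → ∀ x < μ t, Q x t ≤ Q x (t + 1)

/-- Dominance of a triple `(P, Q, ρ)`: within each rectangle block, the
sequence `ρ - ζ` (read right to left) is weakly decreasing, where
`ζ = θ - η` with `η`, `θ` the symmetrized offset vectors of `P`, `Q`. -/
def Dominant (m n s : ℕ) (μ : ℕ → ℕ) (P Q : ℕ → ℕ → ℤ) (ρ : ℕ → ℤ) : Prop :=
  ∀ t : ℕ, t + 1 < s → μ t = μ (t + 1) →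
    ρ t - ((etaCol n μ Q t : ℤ) - (etaCol m μ P t : ℤ)) ≤
      ρ (t + 1) - ((etaCol n μ Q (t + 1) : ℤ) - (etaCol m μ P (t + 1) : ℤ))

/-- `κ₀(A) = (P, Q, ρ)` with all data normalized outside the shape. -/
def Kappa0RelPad (m n : ℕ) (A : Mat) (s : ℕ) (μ : ℕ → ℕ) (P Q : ℕ → ℕ → ℤ)
    (ρ : ℕ → ℤ) : Prop :=
  ∃ P' Q' : ℕ → ℕ → ℤ,
    Kappa0Rel m n A s μ P' Q' ρ ∧
    (∀ t < s, ∀ x < μ t, P x t = P' x t ∧ Q x t = Q' x t) ∧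
    PadZeroT s μ P ∧ PadZeroT s μ Q ∧ (∀ t : ℕ, s ≤ t → μ t = 0) ∧
      ∀ t : ℕ, s ≤ t → ρ t = 0

/-- Membership in `Ω_dom`. -/
def InOmegaDom (m n s : ℕ) (μ : ℕ → ℕ) (P Q : ℕ → ℕ → ℤ) (ρ : ℕ → ℤ) : Prop :=
  ShapeOK m n s μ ∧ PadZeroT s μ P ∧ PadZeroT s μ Q ∧ (∀ t : ℕ, s ≤ t → ρ t = 0) ∧
  (∀ t < s, ∀ x : ℕ, x + 1 < μ t → P x t < P (x + 1) t) ∧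
  (∀ t < s, ∀ x < μ t, 1 ≤ P x t ∧ P x t ≤ (m : ℤ)) ∧
  (∀ t < s, ∀ x : ℕ, x + 1 < μ t → Q x t < Q (x + 1) t) ∧
  (∀ t < s, ∀ x < μ t, 1 ≤ Q x t ∧ Q x t ≤ (n : ℤ)) ∧
    Dominant m n s μ P Q ρ

/-- `A` has width `l`: some proper numbering has period `l`. -/
def HasWidth (m n : ℕ) (A : Mat) (l : ℕ) : Prop :=
  ∃ d : Cell → ℤ, IsProper A d ∧ ∀ c ∈ supp A, d (tauC m n c) = d c + (l : ℤ)

/-! ### Crystal operators on matrices -/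

/-- The first `+` of column `j` (row `i`) survives the signature reduction of
the sequence `σ` attached to rows `i, i+1`. -/
def SurvPlus (A : Mat) (i j : ℤ) : Prop :=
  0 < A i j ∧ ∀ j' : ℤ, j < j' →
    (∑ t ∈ Finset.Ioc j j', A (i + 1) t) ≤ (A i j - 1) + ∑ t ∈ Finset.Ioo j j', A i t

/-- The last `-` of column `j` (row `i+1`) survives the reduction. -/
def SurvMinus (A : Mat) (i j : ℤ) : Prop :=
  0 < A (i + 1) j ∧ ∀ j' : ℤ, j' < j →
    (∑ t ∈ Finset.Ico j' j, A i t) ≤ (A (i + 1) j - 1) + ∑ t ∈ Finset.Ioo j' j, A (i + 1) t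

/-- `A - Ê_{i₁ j} + Ê_{i₂ j}`. -/
noncomputable def subAddAt (m n : ℕ) (i₁ i₂ j : ℤ) (A : Mat) : Mat :=
  fun x y =>
    if ∃ k : ℤ, x = i₁ + k * m ∧ y = j + k * n then A x y - 1
    else if ∃ k : ℤ, x = i₂ + k * m ∧ y = j + k * n then A x y + 1
    else A x y

/-- `f̃_i` on `M̂_{m×n}`, `0`-valued results encoded by `none`. -/
noncomputable def fMat (m n : ℕ) (i : ℤ) (A : Mat) : Option Mat :=
  if h : ∃ j : ℤ, SurvPlus A i j ∧ ∀ j' : ℤ, SurvPlus A i j' → j ≤ j' then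
    some (subAddAt m n i (i + 1) h.choose A)
  else none

/-- `ẽ_i` on `M̂_{m×n}`. -/
noncomputable def eMat (m n : ℕ) (i : ℤ) (A : Mat) : Option Mat :=
  if h : ∃ j : ℤ, SurvMinus A i j ∧ ∀ j' : ℤ, SurvMinus A i j' → j' ≤ j then
    some (subAddAt m n (i + 1) i h.choose A)
  else none

def transM (A : Mat) : Mat := fun i j => A j i

/-- `f̃^t_j A = (f̃_j (Aᵗ))ᵗ`. -/
noncomputable def fMatT (m n : ℕ) (j : ℤ) (A : Mat) : Option Mat :=
  (fMat n m j (transM A)).map transM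

/-- `ẽ^t_j A = (ẽ_j (Aᵗ))ᵗ`. -/
noncomputable def eMatT (m n : ℕ) (j : ℤ) (A : Mat) : Option Mat :=
  (eMat n m j (transM A)).map transM

/-- Row operator (`f̃_i` if `x = true`, `ẽ_i` if `x = false`) on `M̂ ∪ {0}`. -/
noncomputable def rowOp (m n : ℕ) (x : Bool) (i : ℤ) (o : Option Mat) : Option Mat :=
  o.bind (if x then fMat m n i else eMat m n i)

/-- Column operator (`f̃^t_j` or `ẽ^t_j`) on `M̂ ∪ {0}`. -/
noncomputable def colOp (m n : ℕ) (y : Bool) (j : ℤ) (o : Option Mat) : Option Mat :=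
  o.bind (if y then fMatT m n j else eMatT m n j)

/-- The `+` of row `u`, column `j` survives the signature reduction of the
sequence attached to columns `j, j+1` (read along rows, top to bottom). -/
def ColSurvPlus (A : Mat) (j u : ℤ) : Prop :=
  0 < A u j ∧ ∀ u' : ℤ, u < u' →
    (∑ i ∈ Finset.Ioc u u', A i (j + 1)) ≤ (A u j - 1) + ∑ i ∈ Finset.Ioo u u', A i j

/-- `A - Ê_{u j} + Ê_{u, j+1}`, the result of `f̃^t_j` acting at row `u`. -/
noncomputable def ftApply (m n : ℕ) (u j : ℤ) (A : Mat) : Mat :=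
  fun x y =>
    if ∃ k : ℤ, x = u + k * m ∧ y = j + k * n then A x y - 1
    else if ∃ k : ℤ, x = u + k * m ∧ y = j + 1 + k * n then A x y + 1
    else A x y

/-! ### Crystal operators on tableaux -/

/-- Column `t` of `P` contributes a `+` for the letter `i`. -/
def PhasPlus (μ : ℕ → ℕ) (P : ℕ → ℕ → ℤ) (i : ℤ) (t : ℕ) : Prop :=
  (∃ x < μ t, P x t = i) ∧ ∀ x < μ t, P x t ≠ i + 1

/-- Column `t` of `P` contributes a `-` for the letter `i`. -/
def PhasMinus (μ : ℕ → ℕ) (P : ℕ → ℕ → ℤ) (i : ℤ) (t : ℕ) : Prop :=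
  (∃ x < μ t, P x t = i + 1) ∧ ∀ x < μ t, P x t ≠ i

/-- The `+` of column `t` survives the tensor-product signature reduction
(factors are the columns read from right to left). -/
def PSurvPlus (μ : ℕ → ℕ) (P : ℕ → ℕ → ℤ) (i : ℤ) (t : ℕ) : Prop :=
  PhasPlus μ P i t ∧ ∀ t' < t,
    ((Finset.Ico t' t).filter (fun u => PhasMinus μ P i u)).card ≤
      ((Finset.Ioo t' t).filter (fun u => PhasPlus μ P i u)).card

def PSurvMinus (μ : ℕ → ℕ) (P : ℕ → ℕ → ℤ) (i : ℤ) (t : ℕ) : Prop :=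
  PhasMinus μ P i t ∧ ∀ t'' : ℕ, t < t'' →
    ((Finset.Ioc t t'').filter (fun u => PhasPlus μ P i u)).card ≤
      ((Finset.Ioo t t'').filter (fun u => PhasMinus μ P i u)).card

/-- `f̃_i` on `P` acting on column `t₀` (replace the letter `i` by `i + 1`). -/
noncomputable def applyPF (μ : ℕ → ℕ) (P : ℕ → ℕ → ℤ) (i : ℤ) (t₀ : ℕ) :
    ℕ → ℕ → ℤ :=
  fun x t => if t = t₀ ∧ x < μ t ∧ P x t = i then i + 1 else P x t

/-- `ẽ_i` on `P` acting on column `t₀`. -/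
noncomputable def applyPE (μ : ℕ → ℕ) (P : ℕ → ℕ → ℤ) (i : ℤ) (t₀ : ℕ) :
    ℕ → ℕ → ℤ :=
  fun x t => if t = t₀ ∧ x < μ t ∧ P x t = i + 1 then i else P x t

/-- The entry at position `k` of a column `c` of height `b` can be increased. -/
def QmovUp (n b : ℕ) (c : ℕ → ℤ) (k : ℕ) : Prop :=
  (k + 1 < b ∧ c k + 1 < c (k + 1)) ∨ (k + 1 = b ∧ c (b - 1) < c 0 + (n : ℤ) - 1)

/-- The entry at position `k` of a column `c` of height `b` can be decreased. -/
def QmovDown (n b : ℕ) (c : ℕ → ℤ) (k : ℕ) : Prop :=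
  (0 < k ∧ c (k - 1) < c k - 1) ∨ (k = 0 ∧ c (b - 1) < c 0 + (n : ℤ) - 1)

def QhasPlus (n : ℕ) (μ : ℕ → ℕ) (Q : ℕ → ℕ → ℤ) (j : ℤ) (t : ℕ) : Prop :=
  ∃ k < μ t, Int.emod (Q k t) (n : ℤ) = j ∧ QmovUp n (μ t) (fun y => Q y t) k

def QhasMinus (n : ℕ) (μ : ℕ → ℕ) (Q : ℕ → ℕ → ℤ) (j : ℤ) (t : ℕ) : Prop :=
  ∃ k < μ t, Int.emod (Q k t) (n : ℤ) = Int.emod (j + 1) (n : ℤ) ∧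
    QmovDown n (μ t) (fun y => Q y t) k

def QSurvPlus (n : ℕ) (μ : ℕ → ℕ) (Q : ℕ → ℕ → ℤ) (j : ℤ) (t : ℕ) : Prop :=
  QhasPlus n μ Q j t ∧ ∀ t' < t,
    ((Finset.Ico t' t).filter (fun u => QhasMinus n μ Q j u)).card ≤
      ((Finset.Ioo t' t).filter (fun u => QhasPlus n μ Q j u)).card

def QSurvMinus (n : ℕ) (μ : ℕ → ℕ) (Q : ℕ → ℕ → ℤ) (j : ℤ) (t : ℕ) : Prop :=
  QhasMinus n μ Q j t ∧ ∀ t'' : ℕ, t < t'' →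
    ((Finset.Ioc t t'').filter (fun u => QhasPlus n μ Q j u)).card ≤
      ((Finset.Ioo t t'').filter (fun u => QhasMinus n μ Q j u)).card

/-- `f̃^t_j` on `Q` acting on column `t₀`. -/
noncomputable def applyQF (n : ℕ) (μ : ℕ → ℕ) (Q : ℕ → ℕ → ℤ) (j : ℤ) (t₀ : ℕ) :
    ℕ → ℕ → ℤ :=
  fun x t =>
    if t = t₀ ∧ x < μ t ∧ Int.emod (Q x t) (n : ℤ) = j ∧
        QmovUp n (μ t) (fun y => Q y t) x
    then Q x t + 1 else Q x t

/-- `ẽ^t_j` on `Q` acting on column `t₀`. -/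
noncomputable def applyQE (n : ℕ) (μ : ℕ → ℕ) (Q : ℕ → ℕ → ℤ) (j : ℤ) (t₀ : ℕ) :
    ℕ → ℕ → ℤ :=
  fun x t =>
    if t = t₀ ∧ x < μ t ∧ Int.emod (Q x t) (n : ℤ) = Int.emod (j + 1) (n : ℤ) ∧
        QmovDown n (μ t) (fun y => Q y t) x
    then Q x t - 1 else Q x t

/-! ### Standardization -/

noncomputable def rowSumA (A : Mat) (i : ℤ) : ℕ := ∑ᶠ j : ℤ, A i j

noncomputable def colSumA (A : Mat) (j : ℤ) : ℕ := ∑ᶠ i : ℤ, A i j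

/-- `A ∈ M̂_{m×n}(α, β)`. -/
def InMhatAB (m n : ℕ) (α β : ℕ → ℕ) (A : Mat) : Prop :=
  IsGAP m n A ∧ (∀ i : ℕ, 1 ≤ i → i ≤ m → rowSumA A i = α i) ∧
    ∀ j : ℕ, 1 ≤ j → j ≤ n → colSumA A j = β j

/-- Extended affine permutations `W̃_K`. -/
def IsEAP (K : ℕ) (B : Mat) : Prop :=
  IsGAP K K B ∧ (∀ i j : ℤ, B i j ≤ 1) ∧ (∀ i : ℤ, ∃! j : ℤ, B i j ≠ 0) ∧
    ∀ j : ℤ, ∃! i : ℤ, B i j ≠ 0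

/-- `i` is a descent of the matrix `B`. -/
def IsDescentM (B : Mat) (i : ℤ) : Prop :=
  ∃ j j' : ℤ, B i j ≠ 0 ∧ B (i + 1) j' ≠ 0 ∧ j' < j

/-- Partial sums `α₁ + ⋯ + α_i`. -/
def psum (α : ℕ → ℕ) (i : ℕ) : ℕ := ∑ u ∈ Finset.Icc 1 i, α u

/-- `B` is `α`-descending. -/
def AlphaDescending (m : ℕ) (α : ℕ → ℕ) (B : Mat) : Prop :=
  ∀ k : ℕ, 1 ≤ k → k ≤ m → ∀ i : ℤ,
    (psum α (k - 1) : ℤ) < i → i < (psum α k : ℤ) → IsDescentM B i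

/-- `B` is `(α, β)`-descending. -/
def IsABDescending (m n : ℕ) (α β : ℕ → ℕ) (B : Mat) : Prop :=
  AlphaDescending m α B ∧ AlphaDescending n β (transM B)

/-- `B` standardizes `A`: blockwise entry sums of `B` over `𝓘_i × 𝓙_j`
equal the entries of `A`. -/
def PermOf (m n K : ℕ) (α β : ℕ → ℕ) (A B : Mat) : Prop :=
  ∀ (i₀ j₀ : ℕ) (q r : ℤ), 1 ≤ i₀ → i₀ ≤ m → 1 ≤ j₀ → j₀ ≤ n →
    A ((i₀ : ℤ) + q * m) ((j₀ : ℤ) + r * n) =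
      ∑ k ∈ Finset.Icc ((psum α (i₀ - 1) : ℤ) + q * K + 1) ((psum α i₀ : ℤ) + q * K),
        ∑ l ∈ Finset.Icc ((psum β (j₀ - 1) : ℤ) + r * K + 1) ((psum β j₀ : ℤ) + r * K),
          B k l

/-- Standardization of a column-semistandard tableau: for each value `v`, its
occurrences, from left to right, are replaced by consecutive integers starting
after the number of strictly smaller entries. -/
noncomputable def stdT (s : ℕ) (μ : ℕ → ℕ) (T : ℕ → ℕ → ℤ) : ℕ → ℕ → ℤ :=
  fun x t =>
    ((∑ t' ∈ Finset.range s,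
        ((Finset.range (μ t')).filter (fun x' => T x' t' < T x t)).card : ℕ) : ℤ) +
      (((Finset.range t).filter (fun t' => ∃ x' < μ t', T x' t' = T x t)).card : ℤ) + 1

/-- `i` is a (column) descent of the tableau `T`: the letter `i + 1` occurs in
a column strictly to the right of the column containing `i`. -/
def IsDescentT (s : ℕ) (μ : ℕ → ℕ) (T : ℕ → ℕ → ℤ) (i : ℤ) : Prop :=
  ∃ t < s, ∃ t' < s, ∃ x < μ t, ∃ x' < μ t', T x t = i ∧ T x' t' = i + 1 ∧ t < t'

/-! ### Rectangles, `B_n(R)` and `B_n(R)₀` (columns indexed from the right) -/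

/-- `T ∈ B_n(R)` for the rectangle `R = (a^b)`; `T j x` is the entry at row `x`
of the `(j+1)`-st column from the right, normalized to `0` outside the shape. -/
def InBnR (n a b : ℕ) (T : ℕ → ℕ → ℤ) : Prop :=
  (∀ j : ℕ, j + 1 < a → ∀ x < b, T (j + 1) x ≤ T j x) ∧
  (∀ j < a, ∀ x : ℕ, x + 1 < b → T j x < T j (x + 1)) ∧
  (∀ j < a, T j (b - 1) - T j 0 < (n : ℤ)) ∧
    ∀ j x : ℕ, a ≤ j ∨ b ≤ x → T j x = 0

/-- `T ∈ B_n(R)₀`: `(T^{j+1}, τ_n^{-1}(T^j))` is not semistandard for any `j`. -/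
def InBnR0 (n a b : ℕ) (T : ℕ → ℕ → ℤ) : Prop :=
  InBnR n a b T ∧
    ∀ j : ℕ, j + 1 < a → ¬ ∀ x < b, T (j + 1) x ≤ tauPow n b (-1) (fun y => T j y) x

/-- `ν ∈ 𝒫_{a-1}`: a partition `ν₁ ≥ ⋯ ≥ ν_{a-1} ≥ 0`, normalized. -/
def IsPartLen (a : ℕ) (ν : ℕ → ℕ) : Prop :=
  ν 0 = 0 ∧ (∀ j : ℕ, 1 ≤ j → j + 2 ≤ a → ν (j + 1) ≤ ν j) ∧ ∀ j : ℕ, a ≤ j → ν j = 0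

/-- `(T, ν) ↦ τ_n^{ν_rev}(T)`: the column `j` (from the right, 0-based) is
shifted by `τ_n^{ν_{j+1}}`. -/
noncomputable def PhiMap (n a b : ℕ) (T : ℕ → ℕ → ℤ) (ν : ℕ → ℕ) : ℕ → ℕ → ℤ :=
  fun j x => if j < a ∧ x < b then tauPow n b ((ν (j + 1) : ℤ)) (fun y => T j y) x else 0

/-- The offset `r_j` of `T` (columns from the right, paper indexing `j ≥ 1`). -/
noncomputable def rOffR (n b : ℕ) (T : ℕ → ℕ → ℤ) (j : ℕ) : ℕ :=
  sInf {r : ℕ | ∀ x < b, T j x ≤ tauPow n b ((r : ℤ)) (fun y => T (j - 1) y) x}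

/-- The symmetrized offset `η_j = r_j + ⋯ + r_{a-1}`. -/
noncomputable def etaR (n a b : ℕ) (T : ℕ → ℕ → ℤ) (j : ℕ) : ℕ :=
  ∑ u ∈ Finset.Icc j (a - 1), rOffR n b T u

/-! ### The two-column setup -/

/-- Row coordinates of the stream with defining data `(a, ·, ρ)`:
`X(p + ρ + ql) = a(p) + qm` for `1 ≤ p ≤ l`. -/
def streamX (m l : ℕ) (a : ℕ → ℤ) (ρ : ℤ) (idx : ℤ) : ℤ := colExt m l a (idx - ρ - 1)

/-- Column coordinates: `Y(p + ql) = b(p) + qn` for `1 ≤ p ≤ l`. -/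
def streamY (n l : ℕ) (b : ℕ → ℤ) (idx : ℤ) : ℤ := colExt n l b (idx - 1)

/-- The matrix built from the interleaved streams `t` and `t'`. -/
noncomputable def twoColMat (m n l : ℕ) (a1 a2 b1 b2 : ℕ → ℤ) (ρ₁ ρ₂ k : ℤ) : Mat :=
  fun x y =>
    (if ∃ i : ℤ, streamX m l a2 ρ₂ (i + k) = x ∧ streamY n l b1 i = y then 1 else 0) +
      (if ∃ i : ℤ, streamX m l a1 ρ₁ i = x ∧ streamY n l b2 (i + k) = y then 1 else 0)


/-- tail sum `∑_{j' > j} a j'`. -/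
noncomputable def tl (a : ℤ → ℕ) (j : ℤ) : ℕ := ∑ᶠ j' : ℤ, if j < j' then a j' else 0

lemma tl_fin {a : ℤ → ℕ} (ha : {j | a j ≠ 0}.Finite) (j : ℤ) :
    tl a j = ∑ j' ∈ ha.toFinset, if j < j' then a j' else 0 := by
  unfold tl
  apply finsum_eq_sum_of_support_subset
  intro x hx
  simp only [Function.mem_support, ne_eq, ite_eq_right_iff, Classical.not_imp] at hx
  simpa using hx.2

lemma tot_fin {a : ℤ → ℕ} (ha : {j | a j ≠ 0}.Finite) :
    ∑ᶠ j, a j = ∑ j' ∈ ha.toFinset, a j' := by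
  apply finsum_eq_sum_of_support_subset
  intro x hx
  simpa using hx

lemma tl_step {a : ℤ → ℕ} (ha : {j | a j ≠ 0}.Finite) (j : ℤ) :
    tl a (j - 1) = tl a j + a j := by
  rw [tl_fin ha, tl_fin ha]
  have h : a j = ∑ j' ∈ ha.toFinset, if j' = j then a j' else 0 := by
    rw [Finset.sum_ite_eq']
    simp only [Set.Finite.mem_toFinset, Set.mem_ofPred_eq]
    split_ifs with h
    · rfl
    · simpa using h
  conv_rhs => rw [h]
  rw [← Finset.sum_add_distrib]
  apply Finset.sum_congr rfl
  intro x _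
  by_cases h1 : j - 1 < x <;> by_cases h2 : j < x <;> by_cases h3 : x = j <;>
    simp [h1, h2, h3] <;> omega

lemma tl_anti {a : ℤ → ℕ} (ha : {j | a j ≠ 0}.Finite) : Antitone (tl a) := by
  intro x y hxy
  rw [tl_fin ha, tl_fin ha]
  apply Finset.sum_le_sum
  intro z _
  split_ifs <;> omega

lemma tl_le_tot {a : ℤ → ℕ} (ha : {j | a j ≠ 0}.Finite) (j : ℤ) : tl a j ≤ ∑ᶠ j, a j := by
  rw [tl_fin ha, tot_fin ha]
  apply Finset.sum_le_sum
  intro z _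
  split_ifs <;> simp

lemma tl_zero {a : ℤ → ℕ} (ha : {j | a j ≠ 0}.Finite) : ∃ j, tl a j = 0 := by
  obtain ⟨b, hb⟩ := ha.bddAbove
  refine ⟨b, ?_⟩
  rw [tl_fin ha]
  apply Finset.sum_eq_zero
  intro x hx
  have := hb ((Set.Finite.mem_toFinset ha).1 hx)
  rw [if_neg (by omega)]

lemma tl_all {a : ℤ → ℕ} (ha : {j | a j ≠ 0}.Finite) :
    ∃ c, ∀ j ≤ c, tl a j = ∑ᶠ j, a j := by
  obtain ⟨b, hb⟩ := ha.bddBelow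
  refine ⟨b - 1, fun j hj => ?_⟩
  rw [tl_fin ha, tot_fin ha]
  apply Finset.sum_congr rfl
  intro x hx
  have := hb ((Set.Finite.mem_toFinset ha).1 hx)
  rw [if_pos (by omega)]

lemma tl_exists {a : ℤ → ℕ} (ha : {j | a j ≠ 0}.Finite) (x : ℕ) (hx : x < ∑ᶠ j, a j) :
    ∃ j t, t < a j ∧ x = tl a j + t := by
  obtain ⟨c, hc⟩ := tl_all ha
  obtain ⟨d, hd⟩ := tl_zero ha
  obtain ⟨j, hj, hmin⟩ := Int.exists_least_of_bdd (P := fun j => tl a j ≤ x)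
    ⟨c, fun z hz => by
      by_contra h
      have := hc z (by omega)
      omega⟩ ⟨d, by omega⟩
  have h1 : ¬ tl a (j - 1) ≤ x := fun h => by
    have := hmin _ h
    omega
  have := tl_step ha j
  exact ⟨j, x - tl a j, by omega, by omega⟩

/-- row-reading position -/
noncomputable def rp (P : ℤ → ℤ) (A : Mat) (i j : ℤ) (t : ℕ) : ℤ :=
  P (i - 1) + tl (A i) j + t + 1

/-- hypotheses on the row side -/
structure RowOK (P F : ℤ → ℤ) (A : Mat) : Prop where
  mono : Monotone P
  hF : ∀ k i, F k = i ↔ P (i - 1) < k ∧ k ≤ P i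
  fin : ∀ i, {j | A i j ≠ 0}.Finite
  sum : ∀ i, ((∑ᶠ j, A i j : ℕ) : ℤ) = P i - P (i - 1)

lemma rp_F {P F A} (h : RowOK P F A) {i j : ℤ} {t : ℕ} (ht : t < A i j) :
    F (rp P A i j t) = i := by
  rw [h.hF]
  have h1 := tl_step (h.fin i) j
  have h2 := tl_le_tot (h.fin i) (j - 1)
  have h3 := h.sum i
  unfold rp
  constructor <;> omega

lemma rp_lt {P F A} (h : RowOK P F A) {i j j' : ℤ} {t t' : ℕ} (ht' : t' < A i j')
    (hlt : rp P A i j t < rp P A i j' t') : j' < j ∨ (j' = j ∧ t < t') := by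
  rcases lt_trichotomy j' j with h1 | h1 | h1
  · exact Or.inl h1
  · subst h1
    right
    unfold rp at hlt
    exact ⟨rfl, by omega⟩
  · exfalso
    have h2 := tl_step (h.fin i) j'
    have h3 := tl_anti (h.fin i) (show j ≤ j' - 1 by omega)
    unfold rp at hlt
    omega

lemma rp_inj {P F A} (h : RowOK P F A) {i i' j j' : ℤ} {t t' : ℕ} (ht : t < A i j)
    (ht' : t' < A i' j') (he : rp P A i j t = rp P A i' j' t') :
    i = i' ∧ j = j' ∧ t = t' := by
  have hi : i = i' := by rw [← rp_F h ht, he, rp_F h ht']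
  subst hi
  have hj : j = j' := by
    rcases lt_trichotomy j j' with h1 | h1 | h1
    · exfalso
      have h2 := tl_step (h.fin i) j'
      have h3 := tl_anti (h.fin i) (show j ≤ j' - 1 by omega)
      unfold rp at he
      omega
    · exact h1
    · exfalso
      have h2 := tl_step (h.fin i) j
      have h3 := tl_anti (h.fin i) (show j' ≤ j - 1 by omega)
      unfold rp at he
      omega
  subst hj
  unfold rp at he
  exact ⟨rfl, rfl, by omega⟩

lemma rp_surj {P F A} (h : RowOK P F A) (k : ℤ) :
    ∃ i j t, t < A i j ∧ rp P A i j t = k := by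
  obtain ⟨h1, h2⟩ := (h.hF k (F k)).1 rfl
  have h3 := h.sum (F k)
  obtain ⟨j, t, ht, he⟩ := tl_exists (h.fin (F k)) (k - P (F k - 1) - 1).toNat (by omega)
  refine ⟨F k, j, t, ht, ?_⟩
  unfold rp
  omega

/-- the set of balls -/
abbrev Ball (A : Mat) : Type := {s : ℤ × ℤ × ℕ // s.2.2 < A s.1 s.2.1}

def Ball.tr (A : Mat) (s : Ball A) : Ball (transM A) :=
  ⟨(s.1.2.1, s.1.1, A s.1.1 s.1.2.1 - 1 - s.1.2.2), by
    have := s.2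
    simp only [transM]
    omega⟩

lemma Ball.tr_tr (A : Mat) (s : Ball A) : Ball.tr (transM A) (Ball.tr A s) = s := by
  apply Subtype.ext
  have := s.2
  simp only [Ball.tr, transM]
  ext <;> simp only []
  omega

def Ball.trE (A : Mat) : Ball A ≃ Ball (transM A) where
  toFun := Ball.tr A
  invFun := Ball.tr (transM A)
  left_inv := Ball.tr_tr A
  right_inv := Ball.tr_tr (transM A)

noncomputable def ph {P F A} (h : RowOK P F A) : Ball A ≃ ℤ :=
  Equiv.ofBijective (fun s => rp P A s.1.1 s.1.2.1 s.1.2.2) (by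
    constructor
    · rintro ⟨⟨i, j, t⟩, hs⟩ ⟨⟨i', j', t'⟩, hs'⟩ he
      obtain ⟨rfl, rfl, rfl⟩ := rp_inj h hs hs' he
      rfl
    · intro k
      obtain ⟨i, j, t, ht, he⟩ := rp_surj h k
      exact ⟨⟨(i, j, t), ht⟩, he⟩)

lemma ph_apply {P F A} (h : RowOK P F A) (s : Ball A) :
    ph h s = rp P A s.1.1 s.1.2.1 s.1.2.2 := rfl

lemma ph_tr {A Q G} (h' : RowOK Q G (transM A)) (s : Ball A) :
    ph h' (Ball.trE A s) = Q (s.1.2.1 - 1) + tl (transM A s.1.2.1) s.1.1 +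
      ((A s.1.1 s.1.2.1 - 1 - s.1.2.2 : ℕ) : ℤ) + 1 := rfl

/-- decreasing property -/
lemma ph_dec {P F A Q G} (h : RowOK P F A) (h' : RowOK Q G (transM A)) {s s' : Ball A}
    (hi : s.1.1 = s'.1.1) (hlt : ph h s < ph h s') :
    ph h' (Ball.trE A s') < ph h' (Ball.trE A s) := by
  have e1 : G (ph h' (Ball.trE A s)) = s.1.2.1 := rp_F h' (Ball.trE A s).2
  have e2 : G (ph h' (Ball.trE A s')) = s'.1.2.1 := rp_F h' (Ball.trE A s').2
  obtain ⟨⟨i, j, t⟩, hs⟩ := s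
  obtain ⟨⟨i', j', t'⟩, hs'⟩ := s'
  simp only at hi e1 e2
  subst hi
  rcases rp_lt h hs' hlt with h1 | ⟨h1, h2⟩
  · change j' < j at h1
    have a1 := ((h'.hF _ _).1 e1).1
    have a2 := ((h'.hF _ _).1 e2).2
    have a3 := h'.mono (show j' ≤ j - 1 by omega)
    omega
  · change j' = j at h1
    change t < t' at h2
    subst h1
    rw [ph_tr, ph_tr]
    simp only at hs hs' ⊢
    omega

lemma tl_shift {a b : ℤ → ℕ} (n : ℤ) (h : ∀ j, b (j + n) = a j) (j : ℤ) :
    tl b (j + n) = tl a j := by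
  unfold tl
  rw [← finsum_comp_equiv (Equiv.addRight n)]
  apply finsum_congr
  intro x
  simp [h]

lemma rp_shift {P : ℤ → ℤ} {A : Mat} {m n K : ℤ} (hP : ∀ i, P (i + m) = P i + K)
    (hA : ∀ i j, A (i + m) (j + n) = A i j) (i j : ℤ) (t : ℕ) :
    rp P A (i + m) (j + n) t = rp P A i j t + K := by
  unfold rp
  rw [tl_shift n (fun j => hA i j), show i + m - 1 = i - 1 + m by ring, hP]
  ring

lemma mem_blk {P F A} (h : RowOK P F A) (k i : ℤ) :
    k ∈ Finset.Ioc (P (i - 1)) (P i) ↔ F k = i := by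
  rw [h.hF, Finset.mem_Ioc]

lemma exW {P F A Q G} (h : RowOK P F A) (h' : RowOK Q G (transM A)) {m n K : ℤ}
    (hP : ∀ i, P (i + m) = P i + K) (hQ : ∀ i, Q (i + n) = Q i + K)
    (hA : ∀ i j, A (i + m) (j + n) = A i j) :
    ∃ W : ℤ ≃ ℤ, (∀ k, W (k + K) = W k + K) ∧
      (∀ k k', F k = F k' → k < k' → W k' < W k) ∧
      (∀ k k', G k = G k' → k < k' → W.symm k' < W.symm k) ∧
      (∀ i j, A i j = ((Finset.Ioc (P (i - 1)) (P i)).filter (fun k => G (W k) = j)).card) := by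
  let W : ℤ ≃ ℤ := (ph h).symm.trans ((Ball.trE A).trans (ph h'))
  have hW : ∀ s, W (ph h s) = ph h' (Ball.trE A s) := fun s => by
    simp [W]
  have hF : ∀ s, F (ph h s) = s.1.1 := fun s => rp_F h s.2
  have hG : ∀ s, G (ph h' (Ball.trE A s)) = s.1.2.1 := fun s => rp_F h' (Ball.trE A s).2
  refine ⟨W, ?_, ?_, ?_, ?_⟩
  · intro k
    obtain ⟨s, rfl⟩ := (ph h).surjective k
    obtain ⟨⟨i, j, t⟩, hs⟩ := s
    have hs2 : t < A (i + m) (j + n) := by rw [hA]; exact hs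
    have e : ph h ⟨(i + m, j + n, t), hs2⟩ = ph h ⟨(i, j, t), hs⟩ + K := by
      rw [ph_apply, ph_apply]
      exact rp_shift hP hA i j t
    have e' : ph h' (Ball.trE A ⟨(i + m, j + n, t), hs2⟩) =
        ph h' (Ball.trE A ⟨(i, j, t), hs⟩) + K := by
      rw [ph_apply, ph_apply]
      have := rp_shift (A := transM A) hQ (fun a b => hA b a) j i (A i j - 1 - t)
      change rp Q (transM A) (j + n) (i + m) (A (i + m) (j + n) - 1 - t) =
        rp Q (transM A) j i (A i j - 1 - t) + K
      rw [hA]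
      exact this
    rw [← e, hW, hW, e']
  · intro k k' he hlt
    obtain ⟨s, rfl⟩ := (ph h).surjective k
    obtain ⟨s', rfl⟩ := (ph h).surjective k'
    rw [hF, hF] at he
    rw [hW, hW]
    exact ph_dec h h' he hlt
  · intro k k' he hlt
    obtain ⟨s, rfl⟩ := ((Ball.trE A).trans (ph h')).surjective k
    obtain ⟨s', rfl⟩ := ((Ball.trE A).trans (ph h')).surjective k'
    simp only [Equiv.trans_apply] at *
    rw [hG, hG] at he
    rw [← hW, ← hW, Equiv.symm_apply_apply, Equiv.symm_apply_apply]
    have := ph_dec (A := transM A) h' h (s := Ball.trE A s) (s' := Ball.trE A s') he hlt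
    have e1 : ∀ s, Ball.trE (transM A) (Ball.trE A s) = s := Ball.tr_tr A
    rw [e1, e1] at this
    exact this
  · intro i j
    have : (Finset.Ioc (P (i - 1)) (P i)).filter (fun k => G (W k) = j) =
        (Finset.range (A i j)).image (fun t => rp P A i j t) := by
      ext k
      rw [Finset.mem_filter, mem_blk h, Finset.mem_image]
      constructor
      · rintro ⟨h1, h2⟩
        obtain ⟨s, rfl⟩ := (ph h).surjective k
        rw [hF] at h1
        rw [hW, hG] at h2
        subst h1 h2
        exact ⟨s.1.2.2, Finset.mem_range.2 s.2, rfl⟩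
      · rintro ⟨t, ht, rfl⟩
        rw [Finset.mem_range] at ht
        have e : rp P A i j t = ph h ⟨(i, j, t), ht⟩ := rfl
        rw [e, hF, hW, hG]
        exact ⟨rfl, rfl⟩
    rw [this, Finset.card_image_of_injOn, Finset.card_range]
    intro t _ t' _ he
    unfold rp at he
    simp only at he
    omega

lemma tl_card {P F A} (h : RowOK P F A) (c : ℤ → ℤ)
    (hc : ∀ i j, A i j = ((Finset.Ioc (P (i - 1)) (P i)).filter (fun k => c k = j)).card)
    (i j : ℤ) :
    tl (A i) j = ((Finset.Ioc (P (i - 1)) (P i)).filter (fun k => j < c k)).card := by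
  rw [tl_fin (h.fin i), Finset.card_eq_sum_card_fiberwise (f := c) (t := (h.fin i).toFinset)]
  · apply Finset.sum_congr rfl
    intro x _
    rw [Finset.filter_filter]
    split_ifs with hx
    · rw [hc]
      congr 1
      apply Finset.filter_congr
      intro k _
      constructor
      · rintro rfl
        exact ⟨hx, rfl⟩
      · exact fun h => h.2
    · symm
      rw [Finset.card_eq_zero, Finset.filter_eq_empty_iff]
      rintro k _ ⟨h1, rfl⟩
      exact hx h1
  · intro k hk
    rw [Finset.mem_coe, Finset.mem_filter] at hk
    rw [Finset.mem_coe, Set.Finite.mem_toFinset]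
    change A i (c k) ≠ 0
    rw [hc]
    apply Finset.card_ne_zero_of_mem (a := k)
    rw [Finset.mem_filter]
    exact ⟨hk.1, rfl⟩

lemma uq_row {P F A} (h : RowOK P F A) (c : ℤ → ℤ)
    (hc : ∀ i j, A i j = ((Finset.Ioc (P (i - 1)) (P i)).filter (fun k => c k = j)).card)
    (hanti : ∀ k k', F k = F k' → k ≤ k' → c k' ≤ c k) (k : ℤ) :
    k = rp P A (F k) (c k)
      ((Finset.Ioc (P (F k - 1)) (P (F k))).filter (fun k' => c k' = c k ∧ k' < k)).card := by
  have hk := (h.hF k _).1 rfl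
  have h1 : Finset.Ioc (P (F k - 1)) k = insert k
      ((Finset.Ioc (P (F k - 1)) (P (F k))).filter (fun k' => c k < c k') ∪
      (Finset.Ioc (P (F k - 1)) (P (F k))).filter (fun k' => c k' = c k ∧ k' < k)) := by
    ext x
    simp only [Finset.mem_insert, Finset.mem_union, Finset.mem_filter, mem_blk h]
    rw [Finset.mem_Ioc]
    constructor
    · rintro ⟨a, b⟩
      have hx : F x = F k := (h.hF _ _).2 ⟨a, by omega⟩
      have := hanti x k hx b
      by_cases e : x = k
      · exact Or.inl e
      · right
        rcases this.lt_or_eq with q | q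
        · exact Or.inl ⟨hx, q⟩
        · exact Or.inr ⟨hx, q.symm, by omega⟩
    · rintro (rfl | ⟨hx, q⟩ | ⟨hx, q, q'⟩)
      · exact ⟨hk.1, le_rfl⟩
      · have := (h.hF _ _).1 hx
        refine ⟨this.1, ?_⟩
        by_contra hcon
        have := hanti k x hx.symm (by omega)
        omega
      · have := (h.hF _ _).1 hx
        exact ⟨this.1, q'.le⟩
  have h2 := congrArg Finset.card h1
  rw [Finset.card_insert_of_notMem (by simp), Finset.card_union_of_disjoint, Int.card_Ioc,
    ← tl_card h c hc] at h2
  · unfold rp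
    omega
  · rw [Finset.disjoint_filter]
    rintro x _ a ⟨b, _⟩
    omega

lemma uqW {P F A Q G} (h : RowOK P F A) (h' : RowOK Q G (transM A)) (W : ℤ ≃ ℤ)
    (hd : ∀ k k', F k = F k' → k < k' → W k' < W k)
    (hd' : ∀ k k', G k = G k' → k < k' → W.symm k' < W.symm k)
    (hc : ∀ i j, A i j = ((Finset.Ioc (P (i - 1)) (P i)).filter (fun k => G (W k) = j)).card)
    (k : ℤ) : ∃ i j t, t < A i j ∧ k = rp P A i j t ∧
      W k = rp Q (transM A) j i (A i j - 1 - t) := by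
  have mF : Monotone F := by
    intro a b hab
    by_contra hcon
    have h1 := (h.hF a _).1 rfl
    have h2 := (h.hF b _).1 rfl
    have h3 := h.mono (show F b ≤ F a - 1 by omega)
    omega
  have mG : Monotone G := by
    intro a b hab
    by_contra hcon
    have h1 := (h'.hF a _).1 rfl
    have h2 := (h'.hF b _).1 rfl
    have h3 := h'.mono (show G b ≤ G a - 1 by omega)
    omega
  have hr := uq_row h (fun k => G (W k)) hc (by
    intro a b hab hle
    rcases hle.lt_or_eq with q | q
    · exact mG (hd _ _ hab q).le
    · subst q; exact le_rfl) k
  have hc' : ∀ j i, transM A j i =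
      ((Finset.Ioc (Q (j - 1)) (Q j)).filter (fun l => F (W.symm l) = i)).card := by
    intro j i
    change A i j = _
    rw [hc]
    apply Finset.card_equiv W
    intro x
    simp only [Finset.mem_filter, mem_blk h, mem_blk h', Equiv.symm_apply_apply]
    tauto
  have hl := uq_row h' (fun k => F (W.symm k)) hc' (by
    intro a b hab hle
    rcases hle.lt_or_eq with q | q
    · exact mF (hd' _ _ hab q).le
    · subst q; exact le_rfl) (W k)
  simp only [Equiv.symm_apply_apply] at hl
  set i := F k with hi
  set j := G (W k) with hj
  set t := ((Finset.Ioc (P (i - 1)) (P i)).filter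
    (fun k' => G (W k') = j ∧ k' < k)).card with ht
  have e1 : ((Finset.Ioc (Q (j - 1)) (Q j)).filter
      (fun l => F (W.symm l) = i ∧ l < W k)).card =
      ((Finset.Ioc (P (i - 1)) (P i)).filter (fun k' => G (W k') = j ∧ k < k')).card := by
    symm
    apply Finset.card_equiv W
    intro x
    simp only [Finset.mem_filter, mem_blk h, mem_blk h', Equiv.symm_apply_apply]
    constructor
    · rintro ⟨a, b, c⟩
      exact ⟨b, a, hd _ _ (by rw [a]) c⟩
    · rintro ⟨a, b, c⟩
      refine ⟨b, a, ?_⟩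
      have := hd' _ _ (by rw [a]) c
      simpa using this
  have e2 : A i j = t + 1 +
      ((Finset.Ioc (P (i - 1)) (P i)).filter (fun k' => G (W k') = j ∧ k < k')).card := by
    rw [hc, ht]
    have : (Finset.Ioc (P (i - 1)) (P i)).filter (fun k' => G (W k') = j) =
      (insert k ((Finset.Ioc (P (i - 1)) (P i)).filter (fun k' => G (W k') = j ∧ k' < k))) ∪
      ((Finset.Ioc (P (i - 1)) (P i)).filter (fun k' => G (W k') = j ∧ k < k')) := by
      ext x
      simp only [Finset.mem_insert, Finset.mem_union, Finset.mem_filter, mem_blk h]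
      constructor
      · rintro ⟨a, b⟩
        rcases lt_trichotomy x k with q | q | q
        · exact Or.inl (Or.inr ⟨a, b, q⟩)
        · exact Or.inl (Or.inl q)
        · exact Or.inr ⟨a, b, q⟩
      · rintro ((rfl | q) | q)
        · exact ⟨hi.symm, hj.symm⟩
        · exact ⟨q.1, q.2.1⟩
        · exact ⟨q.1, q.2.1⟩
    rw [this, Finset.card_union_of_disjoint, Finset.card_insert_of_notMem (by simp)]
    rw [Finset.disjoint_left]
    intro x
    simp only [Finset.mem_insert, Finset.mem_filter]
    rintro (rfl | q) ⟨_, _, r⟩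
    · omega
    · omega
  refine ⟨i, j, t, by omega, hr, ?_⟩
  rw [e1] at hl
  have e3 : A i j - 1 - t =
    ((Finset.Ioc (P (i - 1)) (P i)).filter (fun k' => G (W k') = j ∧ k < k')).card := by omega
  rw [e3]
  exact hl

lemma uqW' {P F A Q G} (h : RowOK P F A) (h' : RowOK Q G (transM A)) (W W' : ℤ ≃ ℤ)
    (hd : ∀ k k', F k = F k' → k < k' → W k' < W k)
    (hd' : ∀ k k', G k = G k' → k < k' → W.symm k' < W.symm k)
    (hc : ∀ i j, A i j = ((Finset.Ioc (P (i - 1)) (P i)).filter (fun k => G (W k) = j)).card)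
    (gd : ∀ k k', F k = F k' → k < k' → W' k' < W' k)
    (gd' : ∀ k k', G k = G k' → k < k' → W'.symm k' < W'.symm k)
    (gc : ∀ i j, A i j = ((Finset.Ioc (P (i - 1)) (P i)).filter (fun k => G (W' k) = j)).card) :
    W = W' := by
  ext k
  obtain ⟨i, j, t, h1, h2, h3⟩ := uqW h h' W hd hd' hc k
  obtain ⟨i', j', t', h1', h2', h3'⟩ := uqW h h' W' gd gd' gc k
  obtain ⟨rfl, rfl, rfl⟩ := rp_inj h h1 h1' (h2.symm.trans h2')
  rw [h3, h3']

/-- extended partial sums -/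
def pz (m K : ℕ) (α : ℕ → ℕ) (i : ℤ) : ℤ := (psum α (i % (m : ℤ)).toNat : ℤ) + (i / (m : ℤ)) * K

lemma psum_succ (α : ℕ → ℕ) (i : ℕ) (hi : 1 ≤ i) : psum α i = psum α (i - 1) + α i := by
  obtain ⟨j, rfl⟩ : ∃ j, i = j + 1 := ⟨i - 1, by omega⟩
  unfold psum
  rw [Finset.sum_Icc_succ_top (by omega)]
  rfl

lemma pz_eq {m K : ℕ} {α : ℕ → ℕ} (hm : 0 < m) (hα : psum α m = K) (i : ℕ) (hi : i ≤ m) (q : ℤ) :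
    pz m K α (i + q * m) = psum α i + q * K := by
  have hm' : (m : ℤ) ≠ 0 := by omega
  unfold pz
  rw [Int.add_mul_emod_self_right, Int.add_mul_ediv_right _ _ hm']
  rcases hi.lt_or_eq with h | h
  · rw [Int.emod_eq_of_lt (by omega) (by omega), Int.ediv_eq_zero_of_lt (by omega) (by omega)]
    simp
  · subst h
    rw [Int.emod_self, Int.ediv_self hm', hα]
    simp [psum]
    ring

lemma pz_pred {m K : ℕ} {α : ℕ → ℕ} (hm : 0 < m) (hα : psum α m = K) (i : ℕ) (h1 : 1 ≤ i)
    (hi : i ≤ m) (q : ℤ) :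
    pz m K α (i + q * m - 1) = psum α (i - 1) + q * K := by
  rw [← pz_eq hm hα (i - 1) (by omega)]
  congr 1
  push_cast [h1]
  ring

lemma idx_dec {m : ℕ} (hm : 0 < m) (i : ℤ) :
    ∃ (i₀ : ℕ) (q : ℤ), 1 ≤ i₀ ∧ i₀ ≤ m ∧ i = i₀ + q * m := by
  have h1 := Int.emod_nonneg (i - 1) (show (m : ℤ) ≠ 0 by omega)
  have h2 := Int.emod_lt_of_pos (i - 1) (show (0 : ℤ) < m by omega)
  have h3 := Int.emod_add_mul_ediv (i - 1) m
  refine ⟨((i - 1) % m).toNat + 1, (i - 1) / m, by omega, by omega, ?_⟩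
  push_cast
  rw [Int.toNat_of_nonneg h1]
  linarith

lemma pz_shift {m K : ℕ} {α : ℕ → ℕ} (hm : 0 < m) (i : ℤ) :
    pz m K α (i + m) = pz m K α i + K := by
  unfold pz
  rw [Int.add_emod_right, Int.add_ediv_of_dvd_right (dvd_refl _), Int.ediv_self (by omega)]
  ring

lemma pz_mono {m K : ℕ} {α : ℕ → ℕ} (hm : 0 < m) (hα : psum α m = K) : Monotone (pz m K α) := by
  apply monotone_int_of_le_succ
  intro i
  obtain ⟨i₀, q, h1, h2, h3⟩ := idx_dec hm (i + 1)
  rw [h3, pz_eq hm hα _ h2, show i = i₀ + q * m - 1 by omega, pz_pred hm hα _ h1 h2,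
    psum_succ α i₀ h1]
  push_cast
  omega

lemma pz_F {m K : ℕ} {α : ℕ → ℕ} (hm : 0 < m) (hK : 0 < K) (hα : psum α m = K) :
    ∃ F : ℤ → ℤ, ∀ k i, F k = i ↔ pz m K α (i - 1) < k ∧ k ≤ pz m K α i := by
  have hmono := pz_mono hm hα
  have h0 : ∀ q : ℤ, pz m K α (q * m) = q * K := by
    intro q
    have := pz_eq hm hα 0 (by omega) q
    simpa [psum] using this
  have key : ∀ k : ℤ, ∃ i, pz m K α (i - 1) < k ∧ k ≤ pz m K α i := by
    intro k
    obtain ⟨i, hi, hmin⟩ := Int.exists_least_of_bdd (P := fun i => k ≤ pz m K α i)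
      ⟨-(|k| + 1) * m, fun z hz => by
        by_contra h
        have := hmono (show z ≤ -(|k| + 1) * m by omega)
        rw [h0] at this
        have h3 := neg_abs_le k
        have h4 : (1 : ℤ) ≤ K := by omega
        nlinarith [abs_nonneg k]⟩
      ⟨|k| * m, by
        rw [h0]
        have h3 := le_abs_self k
        have h4 : (1 : ℤ) ≤ K := by omega
        nlinarith [abs_nonneg k]⟩
    refine ⟨i, ?_, hi⟩
    by_contra h
    have := hmin (i - 1) (by omega)
    omega
  choose F hF using key
  refine ⟨F, fun k i => ⟨?_, ?_⟩⟩
  · rintro rfl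
    exact hF k
  · rintro ⟨h1, h2⟩
    have h3 := hF k
    rcases lt_trichotomy (F k) i with h | h | h
    · have := hmono (show F k ≤ i - 1 by omega)
      omega
    · exact h
    · have := hmono (show i ≤ F k - 1 by omega)
      omega

lemma eap_iff (K : ℕ) (B : Mat) : IsEAP K B ↔
    ∃ W : ℤ ≃ ℤ, (∀ k, W (k + K) = W k + K) ∧ B = fun k l => if W k = l then 1 else 0 := by
  constructor
  · rintro ⟨⟨h1, _⟩, h2, h3, h4⟩
    choose f hf hf' using h3
    choose g hg hg' using h4
    simp only at hf' hg'
    refine ⟨⟨f, g, fun k => (hg' _ _ (hf k)).symm, fun l => (hf' _ _ (hg l)).symm⟩, ?_, ?_⟩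
    · intro k
      symm
      apply hf'
      rw [h1]
      exact hf k
    · funext k l
      change B k l = if f k = l then 1 else 0
      split_ifs with h
      · subst h
        have := hf k
        have := h2 k (f k)
        omega
      · by_contra h'
        exact h (hf' k l h').symm
  · rintro ⟨W, hW, rfl⟩
    refine ⟨⟨?_, ?_⟩, ?_, ?_, ?_⟩
    · intro i j
      simp only [hW, add_left_inj]
    · intro j
      apply (Set.finite_singleton (W.symm j)).subset
      intro i hi
      have : W i = j := by
        by_contra h
        simp [h] at hi
      simp [← this]
    · intro i j
      simp only
      split_ifs <;> omega
    · intro i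
      refine ⟨W i, by simp, fun y hy => ?_⟩
      by_contra h
      simp [Ne.symm h] at hy
    · intro j
      refine ⟨W.symm j, by simp, fun y hy => ?_⟩
      have : W y = j := by
        by_contra h
        simp [h] at hy
      simp [← this]

lemma W_shift {K : ℕ} {W : ℤ ≃ ℤ} (hW : ∀ k, W (k + K) = W k + K) (q k : ℤ) :
    W (k + q * K) = W k + q * K := by
  induction q using Int.induction_on generalizing k with
  | zero => simp
  | succ i ih =>
    have := hW (k + i * K)
    rw [ih] at this
    rw [show k + (i + 1 : ℤ) * K = k + i * K + K by ring, this]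
    ring
  | pred i ih =>
    have := hW (k + (-i - 1) * K)
    rw [show k + (-i - 1 : ℤ) * K + K = k + (-i : ℤ) * K by ring, ih] at this
    linarith

lemma W_symm_shift {K : ℕ} {W : ℤ ≃ ℤ} (hW : ∀ k, W (k + K) = W k + K) (k : ℤ) :
    W.symm (k + K) = W.symm k + K := by
  rw [Equiv.symm_apply_eq, hW, Equiv.apply_symm_apply]

lemma desc_W (W : ℤ ≃ ℤ) (k : ℤ) :
    IsDescentM (fun k l => if W k = l then 1 else 0) k ↔ W (k + 1) < W k := by
  unfold IsDescentM
  constructor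
  · rintro ⟨j, j', h1, h2, h3⟩
    have e1 : W k = j := by
      by_contra h
      simp [h] at h1
    have e2 : W (k + 1) = j' := by
      by_contra h
      simp [h] at h2
    omega
  · intro h
    exact ⟨_, _, by simp, by simp, h⟩

lemma alpha_iff {m K : ℕ} {α : ℕ → ℕ} (hm : 0 < m) (hα : psum α m = K) {F : ℤ → ℤ}
    (hF : ∀ k i, F k = i ↔ pz m K α (i - 1) < k ∧ k ≤ pz m K α i)
    {W : ℤ ≃ ℤ} (hW : ∀ k, W (k + K) = W k + K) :
    AlphaDescending m α (fun k l => if W k = l then 1 else 0) ↔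
      ∀ k k', F k = F k' → k < k' → W k' < W k := by
  unfold AlphaDescending
  simp only [desc_W]
  constructor
  · intro h
    have step : ∀ k, F k = F (k + 1) → W (k + 1) < W k := by
      intro k hk
      obtain ⟨i₀, q, h1, h2, h3⟩ := idx_dec hm (F k)
      have a1 := (hF k _).1 rfl
      have a2 := (hF (k + 1) _).1 hk.symm
      rw [h3, pz_pred hm hα _ h1 h2, pz_eq hm hα _ h2] at a1 a2
      have := h i₀ h1 h2 (k + (-q) * K) (by linarith) (by linarith)
      rw [show k + (-q) * (K : ℤ) + 1 = k + 1 + (-q) * K by ring, W_shift hW, W_shift hW] at this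
      linarith
    intro k k' he hlt
    obtain ⟨d, rfl⟩ : ∃ d : ℕ, k' = k + 1 + d := ⟨(k' - k - 1).toNat, by omega⟩
    clear hlt
    induction d with
    | zero => simpa using step k (by simpa using he)
    | succ d ih =>
      have a1 := (hF k _).1 rfl
      have a2 := (hF (k + 1 + (d + 1 : ℕ)) _).1 he.symm
      push_cast at a2
      have b : F (k + 1 + d) = F k := (hF _ _).2 ⟨by omega, by omega⟩
      have s1 := ih b.symm
      have s2 := step (k + 1 + d) (by rw [b, he]; congr 1; push_cast; ring)
      have : k + 1 + ((d + 1 : ℕ) : ℤ) = k + 1 + d + 1 := by push_cast; ring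
      rw [this]
      omega
  · intro h k h1 h2 i h3 h4
    have e1 := pz_pred hm hα k h1 h2 0
    have e2 := pz_eq hm hα k h2 0
    simp only [zero_mul, add_zero] at e1 e2
    apply h
    · rw [(hF i k).2 ⟨by omega, by omega⟩, (hF (i + 1) k).2 ⟨by omega, by omega⟩]
    · omega

lemma permOf_iff {m n K : ℕ} {α β : ℕ → ℕ} (hm : 0 < m) (hα : psum α m = K)
    (hn : 0 < n) (hβ : psum β n = K) {G : ℤ → ℤ}
    (hG : ∀ k i, G k = i ↔ pz n K β (i - 1) < k ∧ k ≤ pz n K β i)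
    (W : ℤ ≃ ℤ) (A : Mat) :
    PermOf m n K α β A (fun k l => if W k = l then 1 else 0) ↔
      ∀ i j, A i j = ((Finset.Ioc (pz m K α (i - 1)) (pz m K α i)).filter
        (fun k => G (W k) = j)).card := by
  have key : ∀ (i₀ j₀ : ℕ) (q r : ℤ), 1 ≤ i₀ → i₀ ≤ m → 1 ≤ j₀ → j₀ ≤ n →
      (∑ k ∈ Finset.Icc ((psum α (i₀ - 1) : ℤ) + q * K + 1) ((psum α i₀ : ℤ) + q * K),
        ∑ l ∈ Finset.Icc ((psum β (j₀ - 1) : ℤ) + r * K + 1) ((psum β j₀ : ℤ) + r * K),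
          if W k = l then 1 else 0) =
      ((Finset.Ioc (pz m K α (i₀ + q * m - 1)) (pz m K α (i₀ + q * m))).filter
        (fun k => G (W k) = j₀ + r * n)).card := by
    intro i₀ j₀ q r h1 h2 h3 h4
    rw [← pz_pred hm hα _ h1 h2, ← pz_eq hm hα _ h2, ← pz_pred hn hβ _ h3 h4,
      ← pz_eq hn hβ _ h4, Finset.card_filter]
    apply Finset.sum_congr
    · ext x
      simp only [Finset.mem_Icc, Finset.mem_Ioc]
      omega
    · intro x _
      rw [Finset.sum_ite_eq]
      apply if_congr _ rfl rfl
      rw [hG, Finset.mem_Icc]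
      omega
  unfold PermOf
  constructor
  · intro h i j
    obtain ⟨i₀, q, h1, h2, rfl⟩ := idx_dec hm i
    obtain ⟨j₀, r, h3, h4, rfl⟩ := idx_dec hn j
    rw [h i₀ j₀ q r h1 h2 h3 h4, key i₀ j₀ q r h1 h2 h3 h4]
  · intro h i₀ j₀ q r h1 h2 h3 h4
    rw [h, key i₀ j₀ q r h1 h2 h3 h4]

lemma per_shift {m n : ℕ} {A : Mat} (hA : ∀ i j : ℤ, A (i + m) (j + n) = A i j) (q i j : ℤ) :
    A (i + q * m) (j + q * n) = A i j := by
  induction q using Int.induction_on with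
  | zero => simp
  | succ k ih =>
    rw [← ih, ← hA (i + k * m)]
    congr 1 <;> ring
  | pred k ih =>
    rw [← ih, ← hA (i + (-k - 1) * m)]
    congr 1 <;> ring

lemma rowOK_of {m n K : ℕ} {α : ℕ → ℕ} (hm : 0 < m) (hα : psum α m = K)
    {F : ℤ → ℤ} (hF : ∀ k i, F k = i ↔ pz m K α (i - 1) < k ∧ k ≤ pz m K α i) {A : Mat}
    (hA : ∀ i j : ℤ, A (i + m) (j + n) = A i j) (hfin : ∀ i, {j | A i j ≠ 0}.Finite)
    (hs : ∀ i : ℕ, 1 ≤ i → i ≤ m → ∑ᶠ j, A i j = α i) : RowOK (pz m K α) F A where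
  mono := pz_mono hm hα
  hF := hF
  fin := hfin
  sum := by
    intro i
    obtain ⟨i₀, q, h1, h2, rfl⟩ := idx_dec hm i
    rw [pz_pred hm hα _ h1 h2, pz_eq hm hα _ h2, psum_succ α i₀ h1]
    have : ∑ᶠ j, A (i₀ + q * m) j = ∑ᶠ j, A i₀ j := by
      rw [← finsum_comp_equiv (Equiv.addRight (q * (n : ℤ)))]
      apply finsum_congr
      intro j
      exact per_shift hA q i₀ j
    rw [this, hs i₀ h1 h2]
    push_cast
    ring

lemma row_fin {m n : ℕ} (hm : 0 < m) (hn : 0 < n) {A : Mat} (h : IsGAP m n A) (i : ℤ) :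
    {j | A i j ≠ 0}.Finite := by
  have hsub : {j | A i j ≠ 0} ⊆ ⋃ j₀ ∈ Finset.Icc 1 n,
      (fun r : ℤ => ((j₀ : ℕ) : ℤ) + r * n) '' ((fun r : ℤ => i + (-r) * m) ⁻¹' {i' | A i' j₀ ≠ 0}) := by
    intro j hj
    obtain ⟨j₀, r, h1, h2, rfl⟩ := idx_dec hn j
    refine Set.mem_biUnion (x := j₀) (Finset.mem_coe.2 (Finset.mem_Icc.2 ⟨h1, h2⟩)) ?_
    refine ⟨r, ?_, rfl⟩
    change A (i + (-r) * m) j₀ ≠ 0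
    have hj : A i (j₀ + r * n) ≠ 0 := hj
    rw [← per_shift h.1 (-r)] at hj
    convert hj using 2
    ring
  refine Set.Finite.subset ?_ hsub
  apply Set.Finite.biUnion (Finset.finite_toSet _)
  intro j₀ _
  apply Set.Finite.image
  apply (h.2 j₀).preimage
  intro x _ y _ hxy
  have hm' : (m : ℤ) ≠ 0 := by omega
  simp only [add_right_inj, mul_eq_mul_right_iff, neg_inj, hm', or_false] at hxy
  exact hxy

lemma sum_fib (s : Finset ℤ) (c : ℤ → ℤ) :
    {j | (s.filter (fun k => c k = j)).card ≠ 0}.Finite ∧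
      ∑ᶠ j, (s.filter (fun k => c k = j)).card = s.card := by
  have hsub : {j | (s.filter (fun k => c k = j)).card ≠ 0} ⊆ (s.image c : Finset ℤ) := by
    intro j hj
    have hj : (s.filter (fun k => c k = j)).card ≠ 0 := hj
    rw [Finset.card_ne_zero] at hj
    obtain ⟨k, hk⟩ := hj
    rw [Finset.mem_filter] at hk
    rw [Finset.mem_coe, Finset.mem_image]
    exact ⟨k, hk⟩
  refine ⟨(Finset.finite_toSet _).subset hsub, ?_⟩
  rw [finsum_eq_sum_of_support_subset _ (s := s.image c) hsub]
  symm
  apply Finset.card_eq_sum_card_fiberwise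
  intro k hk
  rw [Finset.mem_coe] at *
  exact Finset.mem_image_of_mem c hk

/-- For `α ∈ (ℤ≥0)^m`, `β ∈ (ℤ≥0)^n` with `|α| = |β| = K > 1`,
the blockwise-sum map restricts to a bijection from the set `W̃_{K,(α,β)}` of
`(α, β)`-descending extended affine permutations onto `M̂_{m×n}(α, β)`. -/
theorem standardization_bijection (m n K : ℕ) (hm : 0 < m) (hn : 0 < n)
    (hK : 1 < K) (α β : ℕ → ℕ) (hα : psum α m = K) (hβ : psum β n = K) :
    (∀ B : Mat, IsEAP K B → IsABDescending m n α β B →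
      ∃! A : Mat, InMhatAB m n α β A ∧ PermOf m n K α β A B) ∧
    ∀ A : Mat, InMhatAB m n α β A →
      ∃! B : Mat, IsEAP K B ∧ IsABDescending m n α β B ∧
        PermOf m n K α β A B := by
  have hK0 : 0 < K := by omega
  obtain ⟨F, hF⟩ := pz_F hm hK0 hα
  obtain ⟨G, hG⟩ := pz_F hn hK0 hβ
  have hT : ∀ W : ℤ ≃ ℤ, transM (fun k l => if W k = l then 1 else 0) =
      fun k l => if W.symm k = l then 1 else 0 := by
    intro W
    funext k l
    simp only [transM]
    apply if_congr _ rfl rfl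
    rw [Equiv.symm_apply_eq, eq_comm]
  constructor
  · intro B hB _
    obtain ⟨W, hW, rfl⟩ := (eap_iff K B).1 hB
    simp only [permOf_iff hm hα hn hβ hG]
    refine ⟨fun i j => ((Finset.Ioc (pz m K α (i - 1)) (pz m K α i)).filter
        (fun k => G (W k) = j)).card, ⟨⟨⟨?_, ?_⟩, ?_, ?_⟩, fun _ _ => rfl⟩, ?_⟩
    rotate_right
    · rintro A ⟨_, hA⟩
      funext i j
      exact hA i j
    · intro i j
      symm
      apply Finset.card_equiv (Equiv.addRight (K : ℤ))
      intro k
      simp only [Finset.mem_filter, Finset.mem_Ioc, Equiv.coe_addRight, hW, hG,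
        show i + (m : ℤ) - 1 = i - 1 + m by ring, show j + (n : ℤ) - 1 = j - 1 + n by ring,
        pz_shift hm, pz_shift hn]
      omega
    all_goals
      have hc' : ∀ j i, ((Finset.Ioc (pz m K α (i - 1)) (pz m K α i)).filter
          (fun k => G (W k) = j)).card = ((Finset.Ioc (pz n K β (j - 1)) (pz n K β j)).filter
          (fun l => F (W.symm l) = i)).card := by
        intro j i
        apply Finset.card_equiv W
        intro x
        simp only [Finset.mem_filter, Finset.mem_Ioc, Equiv.symm_apply_apply, hF, hG]
        tauto
    · intro j
      simp only [hc']
      exact (sum_fib _ _).1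
    · intro i h1 h2
      unfold rowSumA
      rw [(sum_fib _ _).2, Int.card_Ioc]
      have e1 := pz_pred hm hα i h1 h2 0
      have e2 := pz_eq hm hα i h2 0
      simp only [zero_mul, add_zero] at e1 e2
      rw [e1, e2, psum_succ α i h1]
      omega
    · intro j h1 h2
      unfold colSumA
      simp only [hc']
      rw [(sum_fib _ _).2, Int.card_Ioc]
      have e1 := pz_pred hn hβ j h1 h2 0
      have e2 := pz_eq hn hβ j h2 0
      simp only [zero_mul, add_zero] at e1 e2
      rw [e1, e2, psum_succ β j h1]
      omega
  · rintro A ⟨hgap, hr, hc⟩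
    have h : RowOK (pz m K α) F A := rowOK_of hm hα hF hgap.1 (row_fin hm hn hgap) hr
    have h' : RowOK (pz n K β) G (transM A) :=
      rowOK_of (A := transM A) hn hβ hG (fun i j => hgap.1 j i) hgap.2 hc
    obtain ⟨W, hW, w1, w2, w3⟩ := exW h h' (pz_shift hm) (pz_shift hn) hgap.1
    refine ⟨fun k l => if W k = l then 1 else 0, ⟨(eap_iff _ _).2 ⟨W, hW, rfl⟩, ⟨?_, ?_⟩, ?_⟩, ?_⟩
    · exact (alpha_iff hm hα hF hW).2 w1
    · rw [hT]
      exact (alpha_iff hn hβ hG (W_symm_shift hW)).2 w2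
    · exact (permOf_iff hm hα hn hβ hG W A).2 w3
    · rintro B ⟨hB, ⟨hd, hd'⟩, hp⟩
      obtain ⟨V, hV, rfl⟩ := (eap_iff K B).1 hB
      rw [hT] at hd'
      have : V = W := uqW' h h' V W ((alpha_iff hm hα hF hV).1 hd)
        ((alpha_iff hn hβ hG (W_symm_shift hV)).1 hd')
        ((permOf_iff hm hα hn hβ hG V A).1 hp) w1 w2 w3
      rw [this]

end AffineRSK
end

section
/- Let A ∈ M̂_{m×n} be nonzero. (1) For every proper numbering d on A there exists a positive integer ℓ, called the period of d, such that d(τ(c)) = d(c) + ℓ for all c ∈ supp(A). (2) Any two proper numberings on A have the same period; this common value is called the width of A. -/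
open scoped Classical

namespace AffineRSK

def TT (m n : ℕ) (k : ℤ) (c : Cell) : Cell := (c.1 + k * m, c.2 + k * n)

lemma TT_one (m n : ℕ) (c : Cell) : tauC m n c = TT m n 1 c := by
  simp [TT, tauC]

lemma TT_zero (m n : ℕ) (c : Cell) : TT m n 0 c = c := by
  simp [TT]

lemma TT_add (m n : ℕ) (a b : ℤ) (c : Cell) : TT m n a (TT m n b c) = TT m n (a + b) c := by
  simp only [TT, Prod.mk.injEq]; constructor <;> ring

lemma NW_TT (m n : ℕ) (k : ℤ) {c c' : Cell} (h : NW c c') : NW (TT m n k c) (TT m n k c') := by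
  simp only [NW, TT] at *; omega

lemma supp_tau {m n : ℕ} {A : Mat} (hA : IsGAP m n A) (c : Cell) :
    tauC m n c ∈ supp A ↔ c ∈ supp A := by
  simp only [supp, tauC, Set.mem_setOf_eq, hA.1]

lemma supp_TT {m n : ℕ} {A : Mat} (hA : IsGAP m n A) (k : ℤ) (c : Cell) (hc : c ∈ supp A) :
    TT m n k c ∈ supp A := by
  induction k using Int.induction_on with
  | zero => rwa [TT_zero]
  | succ i ih =>
    have h := (supp_tau hA _).2 ih
    rwa [TT_one, TT_add, add_comm] at h
  | pred i ih =>
    rw [← supp_tau hA, TT_one, TT_add]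
    convert ih using 2
    ring

lemma strip {m n : ℕ} (hn : 0 < n) {A : Mat} (hA : IsGAP m n A) :
    ∃ B : ℤ, 0 ≤ B ∧ ∀ c ∈ supp A, |c.1 * n - c.2 * m| ≤ B := by
  have hn' : (0 : ℤ) < n := by exact_mod_cast hn
  have hfin : (⋃ j ∈ Set.Ico (0 : ℤ) n,
      (fun i : ℤ => |i * n - j * m|) '' {i : ℤ | A i j ≠ 0}).Finite :=
    (Set.finite_Ico _ _).biUnion (fun j _ => (hA.2 j).image _)
  obtain ⟨B, hB⟩ := hfin.bddAbove
  refine ⟨max B 0, le_max_right _ _, fun c hc => le_trans (hB ?_) (le_max_left _ _)⟩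
  have h1 := supp_TT hA (-(c.2 / n)) c hc
  have h2 : c.2 + -(c.2 / n) * n = c.2 % n := by
    have := Int.emod_add_mul_ediv c.2 n
    linarith
  simp only [Set.mem_iUnion]
  refine ⟨c.2 % n, ⟨Int.emod_nonneg _ hn'.ne', Int.emod_lt_of_pos _ hn'⟩,
    c.1 + -(c.2 / n) * m, ?_, ?_⟩
  · simp only [TT, h2] at h1
    exact h1
  · simp only [← h2]; congr 1; ring

lemma far {m n : ℕ} (hm : 0 < m) (hn : 0 < n) {A : Mat} (hA : IsGAP m n A) :
    ∃ R : ℕ, 0 < R ∧ ∀ c ∈ supp A, ∀ c' ∈ supp A, c.2 + R ≤ c'.2 → NW c c' := by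
  obtain ⟨B, hB0, hB⟩ := strip hn hA
  have hn' : (0 : ℤ) < n := by exact_mod_cast hn
  have hm' : (1 : ℤ) ≤ m := by exact_mod_cast hm
  refine ⟨(2 * B + 1).toNat, by omega, fun c hc c' hc' h => ?_⟩
  have e : (((2 * B + 1).toNat : ℕ) : ℤ) = 2 * B + 1 := by omega
  rw [e] at h
  have h1 := abs_le.1 (hB c hc)
  have h2 := abs_le.1 (hB c' hc')
  refine ⟨?_, by omega⟩
  have : c.1 * n < c'.1 * n := by nlinarith
  exact lt_of_mul_lt_mul_right this hn'.le

lemma sandwich {m n : ℕ} (hm : 0 < m) (hn : 0 < n) {A : Mat} (hA : IsGAP m n A) :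
    ∃ Q : ℕ, ∀ s ∈ supp A, ∀ c ∈ supp A, ∃ r : ℤ,
      NW (TT m n r s) c ∧ NW c (TT m n (r + Q) s) := by
  obtain ⟨R, hR0, hR⟩ := far hm hn hA
  have hn' : (1 : ℤ) ≤ n := by exact_mod_cast hn
  refine ⟨2 * R + 1, fun s hs c hc => ⟨(c.2 - R - s.2) / n, ?_, ?_⟩⟩
  · apply hR _ (supp_TT hA _ _ hs) _ hc
    have := Int.ediv_mul_le (c.2 - R - s.2) (show (n : ℤ) ≠ 0 by omega)
    simp only [TT]; linarith
  · apply hR _ hc _ (supp_TT hA _ _ hs)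
    have h1 := Int.lt_ediv_add_one_mul_self (c.2 - R - s.2) (show (0 : ℤ) < n by omega)
    simp only [TT]; push_cast
    have : (0 : ℤ) ≤ R := by positivity
    nlinarith

lemma chain {A : Mat} {d : Cell → ℤ} (hd : IsProper A d) (c : Cell) (hc : c ∈ supp A) :
    ∃ z : ℕ → Cell, z 0 = c ∧ (∀ a, z a ∈ supp A) ∧ (∀ a, NW (z (a + 1)) (z a)) ∧
      ∀ a, d (z a) = d c - a := by
  choose! g hg1 hg2 hg3 using hd.2
  have hz : ∀ a : ℕ, (g^[a] c) ∈ supp A := by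
    intro a
    induction a with
    | zero => exact hc
    | succ a ih => rw [Function.iterate_succ_apply']; exact hg1 _ ih
  refine ⟨fun a => g^[a] c, rfl, hz, fun a => ?_, fun a => ?_⟩
  · simp only [Function.iterate_succ_apply']; exact hg2 _ (hz a)
  · induction a with
    | zero => simp
    | succ a ih =>
      simp only [Function.iterate_succ_apply'] at *
      rw [hg3 _ (hz a), ih]; push_cast; ring

lemma chain_drop {A : Mat} {d : Cell → ℤ} (hd : IsProper A d) {z : ℕ → Cell}
    (hz : ∀ a, z a ∈ supp A) (hnw : ∀ a, NW (z (a + 1)) (z a)) (a b : ℕ) :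
    d (z (a + b)) ≤ d (z a) - b := by
  induction b with
  | zero => simp
  | succ b ih =>
    have := hd.1 _ (hz (a + b)) _ (hz (a + b + 1)) (hnw _)
    rw [← add_assoc]; push_cast; omega

lemma chain_col {z : ℕ → Cell} (hnw : ∀ a, NW (z (a + 1)) (z a)) (b : ℕ) :
    (z b).2 ≤ (z 0).2 - b := by
  induction b with
  | zero => simp
  | succ b ih => have := (hnw b).2; push_cast; omega

lemma crossing {m n : ℕ} (hm : 0 < m) (hn : 0 < n) {A : Mat} (hA : IsGAP m n A)
    {d : Cell → ℤ} (hd : IsProper A d) {z : ℕ → Cell} (L : ℕ)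
    (hz : ∀ a, z a ∈ supp A) (hnw : ∀ a, NW (z (a + 1)) (z a))
    (h1 : ∀ a : ℕ, d (z a) = d (z 0) - a) (h2 : ∀ a, d (tauC m n (z a)) = d (z a) + L) :
    ∃ a, NW (z (a + 1)) (tauC m n (z (a + L))) ∧ NW (tauC m n (z (a + 1 + L))) (z a) := by
  by_contra! hcon
  obtain ⟨B, hB0, hB⟩ := strip hn hA
  have hn' : (0 : ℤ) < n := by exact_mod_cast hn
  have hm' : (0 : ℤ) < m := by exact_mod_cast hm
  have hinc : ∀ a, ((z a).1 ≤ (z (a + L)).1 + m ∧ (z (a + L)).2 + n ≤ (z a).2) ∨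
      ((z (a + L)).1 + m ≤ (z a).1 ∧ (z a).2 ≤ (z (a + L)).2 + n) := by
    intro a
    have e : d (tauC m n (z (a + L))) = d (z a) := by
      rw [h2, h1, h1 a]; push_cast; ring
    have hs := (supp_tau hA _).2 (hz (a + L))
    have i1 : ¬ NW (tauC m n (z (a + L))) (z a) := fun h => by
      have := hd.1 _ (hz a) _ hs h; omega
    have i2 : ¬ NW (z a) (tauC m n (z (a + L))) := fun h => by
      have := hd.1 _ hs _ (hz a) h; omega
    simp only [NW, tauC] at i1 i2
    omega
  have hstep : ∀ a, (z (a + 1)).1 < (z a).1 ∧ (z (a + 1)).2 < (z a).2 := hnw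
  have hstep' : ∀ a, (z (a + 1 + L)).1 < (z (a + L)).1 ∧ (z (a + 1 + L)).2 < (z (a + L)).2 := by
    intro a; have := hnw (a + L); rwa [show a + L + 1 = a + 1 + L by ring] at this
  simp only [NW, tauC] at hcon
  have hne : ∀ a, ¬ ((z a).1 = (z (a + L)).1 + m ∧ (z a).2 = (z (a + L)).2 + n) := by
    intro a h
    have := hcon a; have := hstep a; have := hstep' a
    omega
  have key : (∀ a, (z a).1 ≤ (z (a + L)).1 + m ∧ (z (a + L)).2 + n ≤ (z a).2) ∨
      (∀ a, (z (a + L)).1 + m ≤ (z a).1 ∧ (z a).2 ≤ (z (a + L)).2 + n) := by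
    rcases hinc 0 with h | h
    · left
      intro a
      induction a with
      | zero => exact h
      | succ a ih =>
        have := hcon a; have := hstep a; have := hstep' a
        have := hinc (a + 1)
        omega
    · right
      intro a
      induction a with
      | zero => exact h
      | succ a ih =>
        have := hcon a; have := hstep a; have := hstep' a
        have := hinc (a + 1)
        omega
  rcases key with hk | hk
  · have mono : ∀ k : ℕ, (z 0).1 * n - (z 0).2 * m + k ≤ (z (k * L)).1 * n - (z (k * L)).2 * m := by
      intro k
      induction k with
      | zero => simp
      | succ k ih =>
        have h := hk (k * L)
        have h' := hne (k * L)
        rw [show (k + 1) * L = k * L + L by ring]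
        push_cast
        rcases lt_or_ge (z (k * L)).1 ((z (k * L + L)).1 + m) with g | g
        · nlinarith
        · have g' : (z (k * L + L)).2 + n < (z (k * L)).2 := by omega
          nlinarith
    have a1 := abs_le.1 (hB _ (hz 0))
    have a2 := abs_le.1 (hB _ (hz ((2 * B + 1).toNat * L)))
    have a3 := mono (2 * B + 1).toNat
    have e : (((2 * B + 1).toNat : ℕ) : ℤ) = 2 * B + 1 := by omega
    linarith
  · have mono : ∀ k : ℕ, (z (k * L)).1 * n - (z (k * L)).2 * m ≤ (z 0).1 * n - (z 0).2 * m - k := by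
      intro k
      induction k with
      | zero => simp
      | succ k ih =>
        have h := hk (k * L)
        have h' := hne (k * L)
        rw [show (k + 1) * L = k * L + L by ring]
        push_cast
        rcases lt_or_ge ((z (k * L + L)).1 + m) (z (k * L)).1 with g | g
        · nlinarith
        · have g' : (z (k * L)).2 < (z (k * L + L)).2 + n := by omega
          nlinarith
    have a1 := abs_le.1 (hB _ (hz 0))
    have a2 := abs_le.1 (hB _ (hz ((2 * B + 1).toNat * L)))
    have a3 := mono (2 * B + 1).toNat
    have e : (((2 * B + 1).toNat : ℕ) : ℤ) = 2 * B + 1 := by omega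
    linarith

lemma f_bounds {m n : ℕ} (hm : 0 < m) (hn : 0 < n) {A : Mat} (hA : IsGAP m n A)
    {d : Cell → ℤ} (hd : IsProper A d) :
    ∃ N : ℤ, ∀ c ∈ supp A, d c + 1 ≤ d (tauC m n c) ∧ d (tauC m n c) ≤ d c + N := by
  obtain ⟨R, hR0, hR⟩ := far hm hn hA
  refine ⟨R + n, fun c hc => ⟨?_, ?_⟩⟩
  · have := hd.1 _ ((supp_tau hA c).2 hc) _ hc (by simp only [NW, tauC]; omega)
    omega
  · obtain ⟨z, z0, zs, znw, zd⟩ := chain hd _ ((supp_tau hA c).2 hc)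
    have h1 := chain_col znw (R + n)
    rw [z0] at h1
    have h2 := hR _ (zs (R + n)) _ hc (by simp only [tauC] at h1; push_cast at h1; omega)
    have h3 := hd.1 _ hc _ (zs _) h2
    rw [zd] at h3
    push_cast at h3; omega

/-- elements whose first `k+1` translates have minimal jump -/
lemma min_elems {m n : ℕ} (hm : 0 < m) (hn : 0 < n) {A : Mat} (hA : IsGAP m n A)
    {d : Cell → ℤ} (hd : IsProper A d) (L : ℕ)
    (hmin : ∀ c ∈ supp A, d c + L ≤ d (tauC m n c))
    (hex : ∃ c ∈ supp A, d (tauC m n c) = d c + L) (k : ℕ) :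
    ∃ c ∈ supp A, ∀ t : ℕ, t ≤ k → d (TT m n (t + 1) c) = d (TT m n t c) + L := by
  -- closure under single descending steps
  have step : ∀ x ∈ supp A, ∀ y ∈ supp A, NW y x → d y = d x - 1 →
      d (tauC m n x) = d x + L → d (tauC m n y) = d y + L := by
    intro x hx y hy h hdy hx'
    have h1 := hmin y hy
    have h2 := hd.1 _ ((supp_tau hA x).2 hx) _ ((supp_tau hA y).2 hy)
      (by simp only [NW, tauC] at *; omega)
    omega
  have stepk : ∀ x ∈ supp A, ∀ y ∈ supp A, NW y x → d y = d x - 1 → ∀ k : ℕ,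
      (∀ t : ℕ, t ≤ k → d (TT m n (t + 1) x) = d (TT m n t x) + L) →
      (∀ t : ℕ, t ≤ k → d (TT m n (t + 1) y) = d (TT m n t y) + L) := by
    intro x hx y hy h hdy k hk
    have aux : ∀ t : ℕ, t ≤ k → d (TT m n t y) = d (TT m n t x) - 1 ∧
        d (TT m n (t + 1) y) = d (TT m n t y) + L := by
      intro t
      induction t with
      | zero =>
        intro h0
        have e := hk 0 h0
        have := step x hx y hy h hdy (by rw [TT_one]; simpa [TT_zero] using e)
        refine ⟨by simpa [TT_zero] using hdy, ?_⟩
        rw [TT_one] at this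
        simpa [TT_zero] using this
      | succ t ih =>
        intro ht
        obtain ⟨i1, i2⟩ := ih (by omega)
        have e1 := hk t (by omega)
        have e2 := hk (t + 1) ht
        push_cast at e2 ⊢
        have hd' : d (TT m n (t + 1) y) = d (TT m n (t + 1) x) - 1 := by omega
        refine ⟨hd', ?_⟩
        have := step _ (supp_TT hA (t + 1) x hx) _ (supp_TT hA (t + 1) y hy)
          (NW_TT m n (t + 1) h) hd' (by rw [TT_one, TT_add, add_comm]; exact e2)
        rwa [TT_one, TT_add, add_comm] at this
    exact fun t ht => (aux t ht).2
  induction k with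
  | zero =>
    obtain ⟨c, hc, h⟩ := hex
    refine ⟨c, hc, fun t ht => ?_⟩
    obtain rfl : t = 0 := by omega
    rw [TT_one] at h
    simpa [TT_zero] using h
  | succ k ih =>
    obtain ⟨c, hc, h⟩ := ih
    obtain ⟨z, z0, zs, znw, zd⟩ := chain hd c hc
    have zk : ∀ a : ℕ, ∀ t : ℕ, t ≤ k → d (TT m n (t + 1) (z a)) = d (TT m n t (z a)) + L := by
      intro a
      induction a with
      | zero => rw [z0]; exact h
      | succ a ih =>
        exact stepk _ (zs a) _ (zs (a + 1)) (znw a) (by rw [zd, zd]; push_cast; ring) k ih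
    have zf : ∀ a, d (tauC m n (z a)) = d (z a) + L := by
      intro a
      have := zk a 0 (by omega)
      rw [TT_one]
      simpa [TT_zero] using this
    obtain ⟨a, -, ha⟩ := crossing hm hn hA hd L zs znw (by rw [z0]; exact zd) zf
    have hs := zs (a + 1 + L)
    have := stepk _ (zs a) _ ((supp_tau hA _).2 hs) ha
      (by rw [zf, zd, zd]; push_cast; ring) k (zk a)
    refine ⟨_, hs, fun t ht => ?_⟩
    rcases t with _ | t
    · have := zk (a + 1 + L) 0 (by omega)
      exact this
    · have := this t (by omega)
      rw [TT_one, TT_add, TT_add] at this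
      push_cast
      exact this

lemma max_elem {m n : ℕ} (hm : 0 < m) (hn : 0 < n) {A : Mat} (hA : IsGAP m n A)
    {d : Cell → ℤ} (hd : IsProper A d) (M : ℕ) (hM : 0 < M)
    (hmax : ∀ c ∈ supp A, d (tauC m n c) ≤ d c + M)
    (hex : ∃ c ∈ supp A, d (tauC m n c) = d c + M) :
    ∃ c ∈ supp A, ∀ k : ℤ, d (TT m n k c) = d c + k * M := by
  have hd' : IsProper A (fun c => d (tauC m n c)) := by
    constructor
    · intro c₁ h₁ c₂ h₂ h
      exact hd.1 _ ((supp_tau hA _).2 h₁) _ ((supp_tau hA _).2 h₂)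
        (by simp only [NW, tauC] at *; omega)
    · intro c hc
      obtain ⟨y, hy, hnw, hyd⟩ := hd.2 _ ((supp_tau hA _).2 hc)
      have e : tauC m n (TT m n (-1) y) = y := by
        rw [TT_one, TT_add]; simp [TT_zero]
      refine ⟨TT m n (-1) y, supp_TT hA _ _ hy, ?_, by simp only [e]; exact hyd⟩
      simp only [NW, TT, tauC] at *; omega
  obtain ⟨c, hc, hcM⟩ := hex
  obtain ⟨z, z0, zs, znw, zd⟩ := chain hd' c hc
  have hz1 : ∀ a : ℕ, d (z a) = d (z 0) - a := by
    intro a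
    have h1 := chain_drop hd zs znw 0 a
    have h2 := hmax _ (zs a)
    have h3 := zd a
    rw [zero_add] at h1
    rw [z0] at *
    omega
  have hz2 : ∀ a, d (tauC m n (z a)) = d (z a) + M := by
    intro a
    have h3 := zd a
    rw [hz1, h3, hcM, z0]; ring
  obtain ⟨a, ha, -⟩ := crossing hm hn hA hd M zs znw hz1 hz2
  obtain ⟨M', rfl⟩ : ∃ M', M = M' + 1 := ⟨M - 1, by omega⟩
  set x := z (a + (M' + 1)) with hx
  have hxs : x ∈ supp A := zs _
  have hstep : ∀ k : ℤ, d (TT m n (k + 1) x) = d (TT m n k x) + (M' + 1 : ℕ) := by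
    intro k
    apply le_antisymm
    · have := hmax _ (supp_TT hA k x hxs)
      rwa [TT_one, TT_add, add_comm 1 k] at this
    · have h1 := chain_drop hd (z := fun b => TT m n k (z b)) (fun b => supp_TT hA k _ (zs b))
        (fun b => NW_TT m n k (znw b)) (a + 1) M'
      rw [show a + 1 + M' = a + (M' + 1) by ring, ← hx] at h1
      have h2 := NW_TT m n k ha
      rw [TT_one, TT_add] at h2
      have h3 := hd.1 _ (supp_TT hA (k + 1) x hxs) _ (supp_TT hA k _ (zs (a + 1))) h2
      push_cast
      omega
  refine ⟨x, hxs, fun k => ?_⟩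
  induction k using Int.induction_on with
  | zero => simp [TT_zero]
  | succ i ih => rw [hstep, ih]; push_cast; ring
  | pred i ih =>
    have := hstep (-i - 1)
    rw [sub_add_cancel, ih] at this
    push_cast at this ⊢
    linarith

lemma supp_nonempty {A : Mat} (hA0 : A ≠ 0) : ∃ c, c ∈ supp A := by
  by_contra! h
  apply hA0
  funext i j
  have := h (i, j)
  simpa [supp] using this

lemma part1 (m n : ℕ) (hm : 0 < m) (hn : 0 < n)
    (A : Mat) (hA : IsGAP m n A) (hA0 : A ≠ 0) (d : Cell → ℤ) (hd : IsProper A d) :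
      ∃ l : ℕ, 0 < l ∧ ∀ c ∈ supp A, d (tauC m n c) = d c + (l : ℤ) := by
  obtain ⟨N, hN⟩ := f_bounds hm hn hA hd
  obtain ⟨c0, hc0⟩ := supp_nonempty hA0
  obtain ⟨M, ⟨cM, hcM, hM⟩, hMmax⟩ := Int.exists_greatest_of_bdd
    (P := fun v => ∃ c ∈ supp A, d (tauC m n c) = d c + v)
    ⟨N, by rintro v ⟨c, hc, h⟩; have := hN c hc; omega⟩
    ⟨d (tauC m n c0) - d c0, c0, hc0, by ring⟩
  obtain ⟨L, ⟨cL, hcL, hL⟩, hLmin⟩ := Int.exists_least_of_bdd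
    (P := fun v => ∃ c ∈ supp A, d (tauC m n c) = d c + v)
    ⟨1, by rintro v ⟨c, hc, h⟩; have := hN c hc; omega⟩
    ⟨d (tauC m n c0) - d c0, c0, hc0, by ring⟩
  have hM1 : 1 ≤ M := by have := hN _ hcM; omega
  have hL1 : 1 ≤ L := by have := hN _ hcL; omega
  lift M to ℕ using by omega
  lift L to ℕ using by omega
  have hmax : ∀ c ∈ supp A, d (tauC m n c) ≤ d c + M := fun c hc => by
    have := hMmax (d (tauC m n c) - d c) ⟨c, hc, by ring⟩; omega
  have hmin : ∀ c ∈ supp A, d c + L ≤ d (tauC m n c) := fun c hc => by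
    have := hLmin (d (tauC m n c) - d c) ⟨c, hc, by ring⟩; omega
  have hLM : (M : ℤ) ≤ L := by
    by_contra! hlt
    obtain ⟨s, hs, hsk⟩ := max_elem hm hn hA hd M (by omega) hmax ⟨cM, hcM, hM⟩
    obtain ⟨Q, hQ⟩ := sandwich hm hn hA
    obtain ⟨c, hc, hck⟩ := min_elems hm hn hA hd L hmin ⟨cL, hcL, hL⟩ (Q * M)
    have hck' : ∀ t : ℕ, t ≤ Q * M → d (TT m n t c) = d c + t * L := by
      intro t
      induction t with
      | zero => intro _; simp [TT_zero]
      | succ t ih =>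
        intro ht
        have e := hck t (by omega)
        push_cast
        rw [e, ih (by omega)]; ring
    obtain ⟨r, h1, h2⟩ := hQ s hs c hc
    have g1 := hd.1 _ (supp_TT hA _ _ hs) _ hc h2
    have h1' := NW_TT m n ((Q * M : ℕ) : ℤ) h1
    rw [TT_add] at h1'
    have g2 := hd.1 _ (supp_TT hA _ _ hc) _ (supp_TT hA _ _ hs) h1'
    rw [hsk, hck' _ le_rfl] at g2
    rw [hsk] at g1
    push_cast at g1 g2
    have hp : (0 : ℤ) ≤ Q * M := by positivity
    nlinarith
  exact ⟨M, by omega, fun c hc => by have := hmax c hc; have := hmin c hc; omega⟩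

lemma part2 (m n : ℕ) (hm : 0 < m) (hn : 0 < n)
    (A : Mat) (hA : IsGAP m n A) (hA0 : A ≠ 0) (d d' : Cell → ℤ) (l l' : ℕ)
    (hd : IsProper A d) (hd' : IsProper A d')
    (h : ∀ c ∈ supp A, d (tauC m n c) = d c + (l : ℤ))
    (h' : ∀ c ∈ supp A, d' (tauC m n c) = d' c + (l' : ℤ)) : l' ≤ l := by
  by_contra! hlt
  have ext : ∀ (e : Cell → ℤ) (p : ℕ), (∀ c ∈ supp A, e (tauC m n c) = e c + (p : ℤ)) →
      ∀ c ∈ supp A, ∀ k : ℤ, e (TT m n k c) = e c + k * p := by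
    intro e p he c hc k
    have hs : ∀ k : ℤ, e (TT m n (k + 1) c) = e (TT m n k c) + p := by
      intro k
      have := he _ (supp_TT hA k c hc)
      rwa [TT_one, TT_add, add_comm 1 k] at this
    induction k using Int.induction_on with
    | zero => simp [TT_zero]
    | succ i ih => rw [hs, ih]; ring
    | pred i ih =>
      have := hs (-i - 1)
      rw [sub_add_cancel, ih] at this
      linarith
  obtain ⟨c, hc⟩ := supp_nonempty hA0
  obtain ⟨Q, hQ⟩ := sandwich hm hn hA
  obtain ⟨z, z0, zs, znw, zd⟩ := chain hd' c hc
  set N := Q * l' * l' with hNdef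
  obtain ⟨r, h1, h2⟩ := hQ c hc (z N) (zs N)
  have a1 := hd'.1 _ (zs N) _ (supp_TT hA _ _ hc) h1
  have a2 := hd'.1 _ (supp_TT hA _ _ hc) _ (zs N) h2
  have a3 := hd.1 _ (zs N) _ (supp_TT hA _ _ hc) h1
  have a4 := chain_drop hd zs znw 0 N
  rw [zero_add, z0] at a4
  rw [ext d' l' h' c hc, zd] at a1 a2
  rw [ext d l h c hc] at a3
  have b1 : r * l' < -(Q * l' * l' : ℤ) := by
    have : (N : ℤ) = Q * l' * l' := by rw [hNdef]; push_cast; ring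
    linarith
  have b2 : r * l < (r + Q) * l' := by linarith
  have b3 : r < -(Q * l' : ℤ) := by
    have hp : (0 : ℤ) ≤ l' := by positivity
    by_contra! hge
    nlinarith
  have b4 : (l : ℤ) + 1 ≤ l' := by omega
  have hp : (0 : ℤ) ≤ Q * l' := by positivity
  nlinarith

/-- (1) Every proper numbering `d` on a nonzero
`A ∈ M̂_{m×n}` has a period: a positive integer `ℓ` with
`d(τ(c)) = d(c) + ℓ` for all `c ∈ supp A`. (2) Any two proper numberings on
`A` have the same period (the width of `A`). -/
theorem proper_numbering_period (m n : ℕ) (hm : 0 < m) (hn : 0 < n)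
    (A : Mat) (hA : IsGAP m n A) (hA0 : A ≠ 0) :
    (∀ d : Cell → ℤ, IsProper A d →
      ∃ l : ℕ, 0 < l ∧ ∀ c ∈ supp A, d (tauC m n c) = d c + (l : ℤ)) ∧
    ∀ (d d' : Cell → ℤ) (l l' : ℕ), IsProper A d → IsProper A d' →
      (∀ c ∈ supp A, d (tauC m n c) = d c + (l : ℤ)) →
      (∀ c ∈ supp A, d' (tauC m n c) = d' c + (l' : ℤ)) → l = l' := by
  refine ⟨fun d hd => part1 m n hm hn A hA hA0 d hd, fun d d' l l' hd hd' h h' => ?_⟩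
  exact le_antisymm (part2 m n hm hn A hA hA0 d' d l' l hd' hd h' h)
    (part2 m n hm hn A hA hA0 d d' l l' hd hd' h h')

end AffineRSK
end

section
/- Let A ∈ M̂_{m×n} be nonzero, let C be a channel of A, and let d be a proper numbering on A such that d(c) = d^C_A(c) for all c ∈ C. Then the following are equivalent: (1) d = d^C_A; (2) for every c ∈ supp(A) there exists a chain c_k >_NW ⋯ >_NW c_0 in supp(A) with c_0 = c, c_k ∈ C, and d(c_i) = d(c) − i for 0 ≤ i ≤ k; (3) for every proper numbering d′ on A with d′(c) = d^C_A(c) for all c ∈ C, one has d(c) ≤ d′(c) for every c ∈ supp(A). -/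
open scoped Classical

namespace AffineRSK

theorem chan_step (A : Mat) (e : ℤ → Cell) (dC : Cell → ℤ) (hdC : IsChannelNumbering A e dC)
    (c₁ : Cell) (h₁ : c₁ ∈ supp A) (c₂ : Cell) (h₂ : c₂ ∈ supp A) (h : NW c₂ c₁) :
    dC c₂ < dC c₁ := by
  obtain ⟨k, ch, h0, hs, hN, idx, hidx, hv⟩ := (hdC c₂ h₂).1
  have : dC c₂ + 1 ≤ dC c₁ := by
    apply (hdC c₁ h₁).2
    refine ⟨k + 1, fun i => if i = 0 then c₁ else ch (i - 1), by simp, ?_, ?_, idx, by simpa using hidx,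
      by push_cast; omega⟩
    · rintro (_ | i) hi
      · simpa using h₁
      · simpa using hs i (by omega)
    · rintro (_ | i) hi
      · simpa [h0] using h
      · simpa using hN i (by omega)
  omega

theorem chan_chain (A : Mat) (f : Cell → ℤ)
    (hf : ∀ c₁ ∈ supp A, ∀ c₂ ∈ supp A, NW c₂ c₁ → f c₂ < f c₁) (ch : ℕ → Cell) (k : ℕ)
    (hs : ∀ i ≤ k, ch i ∈ supp A) (hN : ∀ i < k, NW (ch (i + 1)) (ch i)) (a b : ℕ)
    (hb : a + b ≤ k) : f (ch (a + b)) + b ≤ f (ch a) := by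
  induction b with
  | zero => simp
  | succ b ih =>
    have h1 := ih (by omega)
    have h2 := hf _ (hs (a + b) (by omega)) _ (hs (a + b + 1) (by omega)) (hN (a + b) (by omega))
    rw [← add_assoc]
    push_cast
    omega

theorem chan_ge (A : Mat) (e : ℤ → Cell) (hsub : ∀ i, e i ∈ supp A) (dC : Cell → ℤ)
    (hdC : IsChannelNumbering A e dC) (i : ℤ) : i ≤ dC (e i) :=
  (hdC _ (hsub i)).2 ⟨0, fun _ => e i, rfl, fun _ _ => hsub i, by simp, i, rfl, by simp⟩

theorem chan_min (A : Mat) (e : ℤ → Cell) (hsub : ∀ i, e i ∈ supp A) (dC : Cell → ℤ)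
    (hdC : IsChannelNumbering A e dC) (d : Cell → ℤ) (hd : IsProper A d)
    (hag : ∀ i, d (e i) = dC (e i)) (c : Cell) (hc : c ∈ supp A) : dC c ≤ d c := by
  obtain ⟨k, ch, h0, hs, hN, idx, hidx, hv⟩ := (hdC c hc).1
  have h1 := chan_chain A d hd.1 ch k hs hN 0 k (by omega)
  rw [Nat.zero_add, h0, ← hidx, hag] at h1
  have := chan_ge A e hsub dC hdC idx
  omega

theorem chan_proper (A : Mat) (e : ℤ → Cell) (hsub : ∀ i, e i ∈ supp A)
    (he : ∀ i, NW (e i) (e (i + 1))) (dC : Cell → ℤ)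
    (hdC : IsChannelNumbering A e dC) : IsProper A dC := by
  refine ⟨chan_step A e dC hdC, fun c hc => ?_⟩
  obtain ⟨k, ch, h0, hs, hN, idx, hidx, hv⟩ := (hdC c hc).1
  rcases Nat.eq_zero_or_pos k with rfl | hk
  · have hn : NW (e (idx - 1)) c := by
      have := he (idx - 1)
      rw [sub_add_cancel, hidx, h0] at this
      exact this
    refine ⟨e (idx - 1), hsub _, hn, ?_⟩
    have h1 := chan_step A e dC hdC c hc _ (hsub _) hn
    have h2 := chan_ge A e hsub dC hdC (idx - 1)
    push_cast at hv
    omega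
  · have hn : NW (ch 1) c := by
      have := hN 0 hk
      rwa [h0] at this
    refine ⟨ch 1, hs 1 hk, hn, ?_⟩
    have h1 := chan_step A e dC hdC c hc _ (hs 1 hk) hn
    have h3 := chan_chain A dC (chan_step A e dC hdC) ch k hs hN 1 (k - 1) (by omega)
    rw [show 1 + (k - 1) = k by omega, ← hidx] at h3
    have h2 := chan_ge A e hsub dC hdC idx
    omega

/-- Characterization of the channel numbering: for a channel
`C` of `A` (enumerated by `e`, with channel numbering `dC`) and a proper
numbering `d` agreeing with `dC` on `C`, the following are equivalent:
(1) `d = dC` on `supp A`; (2) every `c ∈ supp A` admits a chain to `C` along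
which `d` decreases by exactly `1` at each step; (3) `d` is minimal among the
proper numberings agreeing with `dC` on `C`. -/
theorem channel_numbering_characterization (m n : ℕ) (hm : 0 < m) (hn : 0 < n)
    (A : Mat) (hA : IsGAP m n A) (hA0 : A ≠ 0)
    (C : Set Cell) (hC : IsChannel m n A C)
    (e : ℤ → Cell) (l : ℕ) (he : IsStreamEnum m n e l) (hrange : Set.range e = C)
    (dC : Cell → ℤ) (hdC : IsChannelNumbering A e dC)
    (d : Cell → ℤ) (hd : IsProper A d) (hagree : ∀ c ∈ C, d c = dC c) :
    ((∀ c ∈ supp A, d c = dC c) ↔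
      ∀ c ∈ supp A, ∃ (k : ℕ) (ch : ℕ → Cell),
        ch 0 = c ∧ ch k ∈ C ∧ (∀ i ≤ k, ch i ∈ supp A) ∧
        (∀ i < k, NW (ch (i + 1)) (ch i)) ∧
        ∀ i ≤ k, d (ch i) = d c - (i : ℤ)) ∧
    ((∀ c ∈ supp A, d c = dC c) ↔
      ∀ d' : Cell → ℤ, IsProper A d' → (∀ c ∈ C, d' c = dC c) →
        ∀ c ∈ supp A, d c ≤ d' c) := by
  subst hrange
  obtain ⟨_, _, hCs, _⟩ := hC
  have hsub : ∀ i, e i ∈ supp A := fun i => hCs ⟨i, rfl⟩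
  have hstep := chan_step A e dC hdC
  have hge : ∀ c ∈ supp A, dC c ≤ d c :=
    chan_min A e hsub dC hdC d hd (fun i => hagree _ ⟨i, rfl⟩)
  refine ⟨⟨fun h c hc => ?_, fun h c hc => ?_⟩, ⟨fun h d' hd' hag c hc => ?_, fun h c hc => ?_⟩⟩
  · obtain ⟨k, ch, h0, hs, hN, idx, hidx, hv⟩ := (hdC c hc).1
    refine ⟨k, ch, h0, ⟨idx, hidx⟩, hs, hN, fun i hi => ?_⟩
    have h1 := chan_chain A d hd.1 ch k hs hN 0 i (by omega)
    have h2 := chan_chain A d hd.1 ch k hs hN i (k - i) (by omega)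
    rw [Nat.zero_add, h0] at h1
    rw [show i + (k - i) = k by omega, ← hidx, hagree _ ⟨idx, rfl⟩] at h2
    have h3 := chan_ge A e hsub dC hdC idx
    have h4 := h c hc
    omega
  · obtain ⟨k, ch, h0, hk, hs, hN, hv⟩ := h c hc
    have h1 := chan_chain A dC hstep ch k hs hN 0 k (by omega)
    have h2 := hv k le_rfl
    rw [hagree _ hk] at h2
    rw [Nat.zero_add, h0] at h1
    have := hge c hc
    omega
  · rw [h c hc]
    exact chan_min A e hsub dC hdC d' hd' (fun i => hag _ ⟨i, rfl⟩) c hc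
  · exact le_antisymm (h dC (chan_proper A e hsub he.2.1 dC hdC) (fun _ _ => rfl) c hc) (hge c hc)

end AffineRSK
end
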